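/- arXiv:2512.22835 — 4 statements merged into one kernel-verified Lean document; each statement's English description precedes it below -/
import Mathlib

section
/- Let (k,ℓ) = (3,1), let n ≥ 1, and let p = 4m+3 be a prime (so λ = 1 and k+ℓ = 4). Let τ ∈ (0,1] be feasible for 1/4 and assume m ≥ 5/τ and m ≥ 23. If A ⊆ F_p^n is a nontrivial (3,1)-sum-free set with |A| ≥ m·p^{n−1}, then A is normal (type 1 or type 2) or of type 5. -/
open Pointwise

/-- `itSum h A` is the `h`-fold sumset `hA = A + ⋯ + A` (`h` copies), with `itSum 0 A = {0}`. -/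
def itSum {G : Type*} [AddCommMonoid G] : ℕ → Set G → Set G
  | 0, _ => {0}
  | h + 1, A => itSum h A + A

/-- `A` is `(k,ℓ)`-sum-free: the sumsets `kA` and `ℓA` are disjoint. -/
def KLFree {G : Type*} [AddCommMonoid G] (k l : ℕ) (A : Set G) : Prop :=
  itSum k A ∩ itSum l A = ∅

/-- The interval `[a, a+t] = {a, a+1, …, a+t}` in `ZMod p`. -/
def Ival {p : ℕ} (a : ZMod p) (t : ℕ) : Set (ZMod p) :=
  {x | ∃ i : ℕ, i ≤ t ∧ x = a + (i : ZMod p)}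

/-- The cuboid `[a, a+t] × F_p^{n'}` inside the model space `F_p × F_p^{n'}`. -/
def cub (p n' : ℕ) (a : ZMod p) (t : ℕ) : Set (ZMod p × (Fin n' → ZMod p)) :=
  {x | x.1 ∈ Ival a t}

/-- The element `a_j = -(km+1+j)·(k-ℓ)⁻¹` of `F_p`. -/
def ajElt (k l m p j : ℕ) : ZMod p :=
  -((k * m + 1 + j : ℕ) : ZMod p) * (((k - l : ℕ) : ZMod p))⁻¹

/-- The layer `A_i = (A - i·v) ∩ K` of `A` w.r.t. the decomposition `(v, K)`. -/
def layerKL {p n : ℕ} (v : Fin n → ZMod p) (K : Submodule (ZMod p) (Fin n → ZMod p))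
    (A : Set (Fin n → ZMod p)) (i : ZMod p) : Set (Fin n → ZMod p) :=
  {x | x ∈ K ∧ x + i • v ∈ A}

/-- The support `Supp(A) = {i | A_i ≠ ∅}` w.r.t. the decomposition `(v, K)`. -/
def supp {p n : ℕ} (v : Fin n → ZMod p) (K : Submodule (ZMod p) (Fin n → ZMod p))
    (A : Set (Fin n → ZMod p)) : Set (ZMod p) :=
  {i | (layerKL v K A i).Nonempty}

/-- The weight `ω(A) = |Supp(A)|` w.r.t. the decomposition `(v, K)`. -/
noncomputable def weight {p n : ℕ} (v : Fin n → ZMod p)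
    (K : Submodule (ZMod p) (Fin n → ZMod p)) (A : Set (Fin n → ZMod p)) : ℕ :=
  (supp v K A).ncard

/-- `A ⊆ F_p^n` is trivial: isomorphic to a subset of some extremal cuboid `A_{k,ℓ,p,j}`. -/
def IsTrivialKL (k l m lam p n : ℕ) (A : Set (Fin n → ZMod p)) : Prop :=
  ∃ (e : (Fin n → ZMod p) ≃+ (ZMod p × (Fin (n - 1) → ZMod p))) (j : ℕ),
    j < (lam + 2) / 2 ∧ e '' A ⊆ cub p (n - 1) (ajElt k l m p j) m

/-- Type 1. -/
def IsType1 (k l m lam p n : ℕ) (A : Set (Fin n → ZMod p)) : Prop :=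
  A.ncard = m * p ^ (n - 1) ∧
  ∃ (e : (Fin n → ZMod p) ≃+ (ZMod p × (Fin (n - 1) → ZMod p))) (a : ZMod p),
    ((l : ZMod p) * a - (k : ZMod p) * (a + (m : ZMod p) - 1) ∈ Ival (1 : ZMod p) (l - 1) ∨
      (lam + l + 2 ≤ k ∧
        (l : ZMod p) * a - (k : ZMod p) * (a + (m : ZMod p) - 1) ∈
          Ival ((lam + l + 2 : ℕ) : ZMod p) (k - (lam + l + 2)))) ∧
    e '' A = cub p (n - 1) a (m - 1)

/-- The element `a = m·k·(ℓ-k)⁻¹` of `F_p` used in type 2. -/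
def type2a (k l m p : ℕ) : ZMod p :=
  (m : ZMod p) * (k : ZMod p) * (((l : ZMod p) - (k : ZMod p))⁻¹)

/-- Type 2. -/
def IsType2 (k l m p n : ℕ) (A : Set (Fin n → ZMod p)) : Prop :=
  l = 1 ∧ 2 ≤ n ∧ A.ncard = m * p ^ (n - 1) ∧
  ∃ (e : (Fin n → ZMod p) ≃+ (ZMod p × (Fin (n - 1) → ZMod p)))
      (V : Submodule (ZMod p) (Fin (n - 1) → ZMod p)),
    V ≠ ⊤ ∧
    e '' A =
      ({type2a k l m p} ×ˢ (Set.univ \ (V : Set (Fin (n - 1) → ZMod p)))) ∪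
        ((Ival (type2a k l m p + 1) (m - 2)) ×ˢ (Set.univ : Set (Fin (n - 1) → ZMod p))) ∪
        ({type2a k l m p + (m : ZMod p)} ×ˢ (V : Set (Fin (n - 1) → ZMod p)))

/-- Normal: of type 1 or type 2. -/
def IsNormalKL (k l m lam p n : ℕ) (A : Set (Fin n → ZMod p)) : Prop :=
  IsType1 k l m lam p n A ∨ IsType2 k l m p n A

/-- The element `a = (ℓm+k-1)·(k-ℓ)⁻¹` of `F_p` used in type 3. -/
def type3a (k l m p : ℕ) : ZMod p :=
  ((l * m + k - 1 : ℕ) : ZMod p) * (((k - l : ℕ) : ZMod p))⁻¹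

/-- Type 3. -/
def IsType3 (k l m p n : ℕ) (A : Set (Fin n → ZMod p)) : Prop :=
  A.ncard = m * p ^ (n - 1) ∧
  ∃ e : (Fin n → ZMod p) ≃+ (ZMod p × (Fin (n - 1) → ZMod p)),
    e '' A = {x | x.1 ∈ Ival (type3a k l m p - 1) (m + 1) \
      {type3a k l m p, type3a k l m p + (m : ZMod p) - 1}}

/-- Type 4 (for `p = 5m+3`). -/
def IsType4 (m p n : ℕ) (A : Set (Fin n → ZMod p)) : Prop :=
  2 ≤ n ∧ A.ncard = m * p ^ (n - 1) ∧
  ∃ (e : (Fin n → ZMod p) ≃+ (ZMod p × (Fin (n - 1) → ZMod p)))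
      (V : Submodule (ZMod p) (Fin (n - 1) → ZMod p)),
    V ≠ ⊤ ∧
    e '' A =
      (({((2 * m + 1 : ℕ) : ZMod p), ((3 * m + 2 : ℕ) : ZMod p)} : Set (ZMod p)) ×ˢ
          (V : Set (Fin (n - 1) → ZMod p))) ∪
        (({((2 * m + 2 : ℕ) : ZMod p), ((3 * m + 1 : ℕ) : ZMod p)} : Set (ZMod p)) ×ˢ
          (Set.univ \ (V : Set (Fin (n - 1) → ZMod p)))) ∪
        ((Ival ((2 * m + 3 : ℕ) : ZMod p) (m - 3)) ×ˢ (Set.univ : Set (Fin (n - 1) → ZMod p)))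

/-- The set `A₀ ⊆ F_p × F_p^s` used in type 5 (for `p = 4m+3`), with `a = (m+2)/2`. -/
def type5A0 (m p s : ℕ) (P : Set (Fin s → ZMod p)) : Set (ZMod p × (Fin s → ZMod p)) :=
  {(((m + 2 : ℕ) : ZMod p) * (2 : ZMod p)⁻¹ - 1, (0 : Fin s → ZMod p))} ∪
    ({((m + 2 : ℕ) : ZMod p) * (2 : ZMod p)⁻¹} ×ˢ (Set.univ \ P)) ∪
    ((Ival (((m + 2 : ℕ) : ZMod p) * (2 : ZMod p)⁻¹ + 1) (m - 3)) ×ˢ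
      (Set.univ : Set (Fin s → ZMod p))) ∪
    ({((m + 2 : ℕ) : ZMod p) * (2 : ZMod p)⁻¹ + (m : ZMod p) - 1} ×ˢ
      (Set.univ \ {(0 : Fin s → ZMod p)})) ∪
    ({((m + 2 : ℕ) : ZMod p) * (2 : ZMod p)⁻¹ + (m : ZMod p)} ×ˢ P)

/-- Type 5 (for `p = 4m+3`). -/
def IsType5 (m p n : ℕ) (A : Set (Fin n → ZMod p)) : Prop :=
  A.ncard = m * p ^ (n - 1) ∧
  ∃ s : ℕ, s ≤ n - 1 ∧
    ∃ (e : (Fin n → ZMod p) ≃+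
          (ZMod p × (Fin s → ZMod p) × (Fin (n - 1 - s) → ZMod p)))
      (P : Set (Fin s → ZMod p)),
      P.Nonempty ∧ (0 : Fin s → ZMod p) ∉ itSum 3 P ∧
      e '' A = {x | (x.1, x.2.1) ∈ type5A0 m p s P}

/-- `τ` is feasible for `c`. -/
def Feasible (c τ : ℝ) : Prop :=
  ∀ q : ℕ, q.Prime → ∀ B : Set (ZMod q),
    (B.ncard : ℝ) ≤ c * q →
    ((B + B).ncard : ℝ) ≤ (2 + τ) * (B.ncard : ℝ) - 3 →
    ∃ y d : ZMod q, d ≠ 0 ∧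
      B ⊆ {x | ∃ i : ℕ, i ≤ (B + B).ncard - B.ncard ∧ x = y + (i : ZMod q) * d}

/-- A weak form of Kneser's theorem: if every proper subgroup of `G` has at most `M` elements, then
`|A| + |B| ≤ |A + B| + M` unless `A + B` is everything. -/
lemma card_add_card_le_of_add_ne_univ {G : Type*} [AddCommGroup G] [Fintype G] [DecidableEq G]
    {M : ℕ} (hM : ∀ H : AddSubgroup G, H ≠ ⊤ → Nat.card H ≤ M) (A B : Finset G)
    (hA : A.Nonempty) (hB : B.Nonempty) (hAB : A + B ≠ Finset.univ) :
    A.card + B.card ≤ (A + B).card + M := by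
  induction hb : B.card using Nat.strong_induction_on generalizing A B with
  | _ c ih =>
  subst hb
  by_cases hstep : ∃ a ∈ A, ∃ b ∈ B, ∃ b' ∈ B, a - b + b' ∉ A
  · obtain ⟨a, ha, b, hb, b', hb', hn⟩ := hstep
    set e := a - b with he
    set T := B.filter (fun x => e + x ∈ A) with hT
    set R := (B.filter (fun x => e + x ∉ A)).image (fun x => e + x) with hR
    have hTR : T.card + R.card = B.card := by
      rw [hR, Finset.card_image_of_injective _ (add_right_injective e)]
      exact Finset.card_filter_add_card_filter_not _
    have hdisj : Disjoint A R := by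
      rw [Finset.disjoint_right]
      intro x hx
      simp only [hR, Finset.mem_image, Finset.mem_filter] at hx
      obtain ⟨y, hy, rfl⟩ := hx
      exact hy.2
    have hRpos : 0 < R.card := Finset.card_pos.2
      ⟨e + b', Finset.mem_image.2 ⟨b', Finset.mem_filter.2 ⟨hb', hn⟩, rfl⟩⟩
    have hTne : T.Nonempty := ⟨b, Finset.mem_filter.2 ⟨hb, by simpa [he] using ha⟩⟩
    have hsub : (A ∪ R) + T ⊆ A + B := by
      intro x hx
      obtain ⟨y, hy, z, hz, rfl⟩ := Finset.mem_add.1 hx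
      rw [hT, Finset.mem_filter] at hz
      rcases Finset.mem_union.1 hy with hy | hy
      · exact Finset.add_mem_add hy hz.1
      · simp only [hR, Finset.mem_image, Finset.mem_filter] at hy
        obtain ⟨y', hy', rfl⟩ := hy
        have : e + y' + z = (e + z) + y' := by abel
        rw [this]
        exact Finset.add_mem_add hz.2 hy'.1
    have := ih T.card (by omega) (A ∪ R) T (hA.mono Finset.subset_union_left) hTne
      (fun h => hAB (Finset.univ_subset_iff.1 (h ▸ hsub))) rfl
    rw [Finset.card_union_of_disjoint hdisj] at this
    have := Finset.card_le_card hsub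
    omega
  · push Not at hstep
    set H : AddSubgroup G := AddSubgroup.closure {x | ∃ b ∈ B, ∃ b' ∈ B, x = b' - b} with hH
    have hstab : ∀ h ∈ H, ∀ a ∈ A, a + h ∈ A := by
      intro h hh
      induction hh using AddSubgroup.closure_induction with
      | mem x hx =>
        obtain ⟨b, hb, b', hb', rfl⟩ := hx
        intro a ha
        have := hstep a ha b hb b' hb'
        rwa [sub_add_eq_add_sub, add_sub_assoc] at this
      | zero => simp
      | add x y _ _ hx hy =>
        intro a ha
        rw [← add_assoc]
        exact hy _ (hx _ ha)
      | neg x _ hx =>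
        intro a ha
        have hinj : A.image (fun y => y + x) = A :=
          Finset.eq_of_subset_of_card_le
            (fun z hz => by
              obtain ⟨y, hy, rfl⟩ := Finset.mem_image.1 hz
              exact hx y hy)
            (by rw [Finset.card_image_of_injective _ (add_left_injective x)])
        rw [← hinj] at ha
        obtain ⟨y, hy, rfl⟩ := Finset.mem_image.1 ha
        simpa using hy
    have hHtop : H ≠ ⊤ := by
      intro h
      apply hAB
      obtain ⟨a, ha⟩ := hA
      obtain ⟨b, hb⟩ := hB
      refine Finset.eq_univ_iff_forall.2 fun x => ?_
      have := hstab (x - b - a) (h ▸ AddSubgroup.mem_top _) a ha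
      have hx : x = (a + (x - b - a)) + b := by abel
      rw [hx]
      exact Finset.add_mem_add this hb
    have hBM : B.card ≤ Nat.card H := by
      obtain ⟨b, hb⟩ := hB
      rw [← Finset.card_image_of_injective B (sub_left_injective (b := b))]
      rw [← Set.ncard_coe_finset, ← Nat.card_coe_set_eq]
      refine Nat.card_mono (Set.toFinite _) ?_
      intro x hx
      simp only [Finset.coe_image, Set.mem_image, Finset.mem_coe] at hx
      obtain ⟨y, hy, rfl⟩ := hx
      exact AddSubgroup.subset_closure ⟨b, hb, y, hy, rfl⟩
    have h1 : A.card ≤ (A + B).card := Finset.card_le_card_add_right hB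
    have := hM H hHtop
    omega

lemma exists_add_eq_of_card_lt {G : Type*} [AddCommGroup G] [Fintype G] [DecidableEq G]
    (A B : Finset G) (h : Fintype.card G < A.card + B.card) (g : G) :
    ∃ a ∈ A, ∃ b ∈ B, a + b = g := by
  have h1 : (B.image (fun b => g - b)).card = B.card :=
    Finset.card_image_of_injective _ (sub_right_injective)
  obtain ⟨x, hx⟩ := Finset.inter_nonempty_of_card_lt_card_add_card
    (Finset.subset_univ A) (Finset.subset_univ (B.image (fun b => g - b)))
    (by rw [h1, Finset.card_univ]; exact h)
  rw [Finset.mem_inter, Finset.mem_image] at hx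
  obtain ⟨hx, b, hb, rfl⟩ := hx
  exact ⟨_, hx, b, hb, by abel⟩

lemma card_sum_le_of_disjoint {G : Type*} [AddCommGroup G] [Fintype G] [DecidableEq G]
    {M : ℕ} (hM : ∀ H : AddSubgroup G, H ≠ ⊤ → Nat.card H ≤ M) (A B C D : Finset G)
    (hA : A.Nonempty) (hB : B.Nonempty) (hC : C.Nonempty) (hD : D.Nonempty)
    (h : ∀ a ∈ A, ∀ b ∈ B, ∀ c ∈ C, a + b + c ∉ D) :
    A.card + B.card + C.card + D.card ≤ Fintype.card G + 2 * M := by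
  have hdisj : Disjoint (A + B + C) D := by
    rw [Finset.disjoint_left]
    intro x hx
    obtain ⟨y, hy, c, hc, rfl⟩ := Finset.mem_add.1 hx
    obtain ⟨a, ha, b, hb, rfl⟩ := Finset.mem_add.1 hy
    exact h a ha b hb c hc
  have h1 : (A + B + C).card + D.card ≤ Fintype.card G := by
    rw [← Finset.card_union_of_disjoint hdisj]
    exact Finset.card_le_univ _
  have h2 : A + B + C ≠ Finset.univ := by
    intro h2
    rw [h2, Finset.card_univ] at h1
    have := hD.card_pos
    omega
  have h3 : A + B ≠ Finset.univ := by
    intro h3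
    apply h2
    obtain ⟨c, hc⟩ := hC
    refine Finset.eq_univ_iff_forall.2 fun x => ?_
    rw [← sub_add_cancel x c]
    exact Finset.add_mem_add (h3 ▸ Finset.mem_univ _) hc
  have h4 := card_add_card_le_of_add_ne_univ hM A B hA hB h3
  have h5 := card_add_card_le_of_add_ne_univ hM (A + B) C (hA.add hB) hC h2
  omega

lemma card_add_card_le_of_disjoint {G : Type*} [AddCommGroup G] [Fintype G] [DecidableEq G]
    (A B C D : Finset G) (hC : C.Nonempty) (hD : D.Nonempty)
    (h : ∀ a ∈ A, ∀ b ∈ B, ∀ c ∈ C, a + b + c ∉ D) :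
    A.card + B.card ≤ Fintype.card G := by
  by_contra! hlt
  obtain ⟨c, hc⟩ := hC
  obtain ⟨d, hd⟩ := hD
  obtain ⟨a, ha, b, hb, hab⟩ := exists_add_eq_of_card_lt A B hlt (d - c)
  exact h a ha b hb c hc (by rw [hab]; simpa using hd)

lemma card_add_card_le_of_disjoint' {G : Type*} [AddCommGroup G] [Fintype G] [DecidableEq G]
    (A B C D : Finset G) (hB : B.Nonempty) (hC : C.Nonempty)
    (h : ∀ a ∈ A, ∀ b ∈ B, ∀ c ∈ C, a + b + c ∉ D) :
    A.card + D.card ≤ Fintype.card G := by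
  by_contra! hlt
  obtain ⟨b, hb⟩ := hB
  obtain ⟨c, hc⟩ := hC
  obtain ⟨a, ha, d, hd, hab⟩ := exists_add_eq_of_card_lt A (-D) (by simpa using hlt) (-(b + c))
  refine h a ha b hb c hc ?_
  have : a + b + c = -d := by rw [add_assoc, ← neg_neg (b + c), ← hab]; abel
  rw [this]
  simpa using hd

lemma ZMod.card_addSubgroup_le_one {p : ℕ} [Fact p.Prime] (H : AddSubgroup (ZMod p)) (hH : H ≠ ⊤) :
    Nat.card H ≤ 1 := by
  have : Fact (Nat.card (ZMod p)).Prime := ⟨by simpa using (Fact.out : p.Prime)⟩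
  rcases H.eq_bot_or_eq_top_of_prime_card with h | h
  · subst h; simp
  · exact absurd h hH

/-- Proper subgroups of an elementary abelian group of order `p ^ d`. -/
lemma mul_card_addSubgroup_le {p d : ℕ} [Fact p.Prime] {K : Type*} [AddCommGroup K] [Fintype K]
    (hK : Fintype.card K = p ^ d) (H : AddSubgroup K) (hH : H ≠ ⊤) :
    p * Nat.card H ≤ p ^ d := by
  have h1 : Nat.card H ∣ p ^ d := by
    rw [← hK, ← Nat.card_eq_fintype_card]; exact H.card_addSubgroup_dvd_card
  obtain ⟨e, he, h2⟩ := (Nat.dvd_prime_pow Fact.out).1 h1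
  have h3 : e ≠ d := by
    rintro rfl
    apply hH
    apply AddSubgroup.eq_top_of_card_eq
    rw [h2, Nat.card_eq_fintype_card, hK]
  rw [h2, ← pow_succ']
  exact Nat.pow_le_pow_right (Fact.out : p.Prime).pos (by omega)

lemma two_mul_sum_le_of_involution {ι : Type*} (s : Finset ι) (g : ι → ι) (f : ι → ℕ) (c : ℕ)
    (hg : ∀ x ∈ s, g x ∈ s) (hgg : ∀ x ∈ s, g (g x) = x) (hf : ∀ x ∈ s, f x + f (g x) ≤ c) :
    2 * ∑ x ∈ s, f x ≤ s.card * c := by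
  have h : ∑ x ∈ s, f (g x) = ∑ x ∈ s, f x :=
    Finset.sum_nbij' g g hg hg hgg hgg (fun _ _ => rfl)
  calc 2 * ∑ x ∈ s, f x = ∑ x ∈ s, (f x + f (g x)) := by rw [Finset.sum_add_distrib, h]; ring
    _ ≤ s.card * c := by simpa using Finset.sum_le_card_nsmul s _ c hf

/-- The number of indices at which `a` exceeds `t`. -/
def levelCard {ι : Type*} [Fintype ι] (a : ι → ℕ) (t : ℕ) : ℕ :=
  (Finset.univ.filter (fun i => t < a i)).card

lemma sum_eq_sum_levelCard {ι : Type*} [Fintype ι] (a : ι → ℕ) (M : ℕ) (hM : ∀ i, a i ≤ M) :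
    ∑ i, a i = ∑ t ∈ Finset.range M, levelCard a t := by
  simp only [levelCard, Finset.card_filter]
  rw [Finset.sum_comm]
  refine Finset.sum_congr rfl fun i _ => ?_
  rw [← Finset.card_filter]
  have : (Finset.range M).filter (fun t => t < a i) = Finset.range (a i) := by
    ext t
    simp only [Finset.mem_filter, Finset.mem_range]
    have := hM i
    omega
  rw [this, Finset.card_range]

lemma levelCard_anti {ι : Type*} [Fintype ι] (a : ι → ℕ) {s t : ℕ} (h : s ≤ t) :
    levelCard a t ≤ levelCard a s :=
  Finset.card_le_card fun i hi => by
    simp only [Finset.mem_filter, Finset.mem_univ, true_and] at hi ⊢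
    omega

lemma levelCard_add_le {p : ℕ} [Fact p.Prime] (a : ZMod p → ℕ) (i₀ : ZMod p) (t₁ t₂ t₃ t₄ : ℕ)
    (h₁ : t₁ < a i₀) (h₂ : t₂ < a i₀) (h₃ : t₃ < a i₀) (h₄ : t₄ < a i₀)
    (h : ∀ i j k, t₁ < a i → t₂ < a j → t₃ < a k → ¬ t₄ < a (i + j + k)) :
    levelCard a t₁ + levelCard a t₂ + levelCard a t₃ + levelCard a t₄ ≤ p + 2 := by
  have := card_sum_le_of_disjoint (M := 1) (ZMod.card_addSubgroup_le_one (p := p))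
    (Finset.univ.filter (fun i => t₁ < a i)) (Finset.univ.filter (fun i => t₂ < a i))
    (Finset.univ.filter (fun i => t₃ < a i)) (Finset.univ.filter (fun i => t₄ < a i))
    ⟨i₀, by simpa using h₁⟩ ⟨i₀, by simpa using h₂⟩ ⟨i₀, by simpa using h₃⟩
    ⟨i₀, by simpa using h₄⟩
    (by
      intro i hi j hj k hk
      simp only [Finset.mem_filter, Finset.mem_univ, true_and] at *
      exact h i j k hi hj hk)
  simpa [levelCard, ZMod.card] using this

/-- Either all weights are close to the average, or some weight is close to the maximum. -/
lemma weight_dichotomy {p m N N' : ℕ} [Fact p.Prime] (hp : p = 4 * m + 3) (hm : 2 ≤ m)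
    (hN : N = p * N') (hodd : Odd N) (a : ZMod p → ℕ)
    (hquad : ∀ i j k, 0 < a i → 0 < a j → 0 < a k → 0 < a (i + j + k) →
      a i + a j + a k + a (i + j + k) ≤ N + 2 * N')
    (hsum : m * N ≤ ∑ i, a i) :
    (∀ i, a i ≤ (m + 4) * N') ∨ ∃ i, m * N ≤ (m + 1) * a i := by
  obtain ⟨i₀, -, hmax⟩ := Finset.exists_max_image (Finset.univ : Finset (ZMod p)) a
    ⟨0, Finset.mem_univ _⟩
  replace hmax : ∀ i, a i ≤ a i₀ := fun i => hmax i (Finset.mem_univ _)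
  have hlev : ∀ t₁ t₂ t₃ t₄, t₁ < a i₀ → t₂ < a i₀ → t₃ < a i₀ → t₄ < a i₀ →
      N + 2 * N' < t₁ + t₂ + t₃ + t₄ + 4 →
      levelCard a t₁ + levelCard a t₂ + levelCard a t₃ + levelCard a t₄ ≤ p + 2 := by
    intro t₁ t₂ t₃ t₄ h₁ h₂ h₃ h₄ h
    refine levelCard_add_le a i₀ t₁ t₂ t₃ t₄ h₁ h₂ h₃ h₄ fun i j k hi hj hk hl => ?_
    have := hquad i j k (by omega) (by omega) (by omega) (by omega)
    omega
  have hlp : ∀ t, levelCard a t ≤ p := fun t => by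
    have := Finset.card_le_univ (Finset.univ.filter (fun i => t < a i))
    rwa [ZMod.card] at this
  rw [sum_eq_sum_levelCard a (a i₀) hmax] at hsum
  set M := a i₀ with hMdef
  have hN'pos : 0 < N' := by
    rcases Nat.eq_zero_or_pos N' with h | h
    · subst h; subst hN; simp at hodd
    · exact h
  obtain ⟨τ, hτ⟩ : ∃ τ, 2 * τ + 3 = N + 2 * N' := by
    obtain ⟨c, hc⟩ := hodd
    have : 3 ≤ N := by rw [hN, hp]; nlinarith
    exact ⟨c + N' - 1, by omega⟩
  have hpair : ∀ t, t ≤ τ → t < M → τ - t < M →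
      levelCard a t + levelCard a (τ - t) ≤ 2 * m + 2 := by
    intro t h1 h2 h3
    have := hlev t (τ - t) t (τ - t) h2 h3 h2 h3 (by omega)
    omega
  rcases Nat.lt_or_ge τ M with hB | hA
  · right
    refine ⟨i₀, ?_⟩
    have h1 : 2 * ∑ t ∈ Finset.range (τ + 1), levelCard a t ≤ (τ + 1) * (2 * m + 2) := by
      have := two_mul_sum_le_of_involution (Finset.range (τ + 1)) (fun t => τ - t) (levelCard a)
        (2 * m + 2) (fun x hx => by simp at hx ⊢) (fun x hx => by simp at hx; omega)
        (fun x hx => by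
          simp only [Finset.mem_range] at hx
          exact hpair x (by omega) (by omega) (by omega))
      simpa using this
    have h2 : ∑ t ∈ Finset.Ico (τ + 1) M, levelCard a t ≤ (M - (τ + 1)) * (m + 1) := by
      have := Finset.sum_le_card_nsmul (Finset.Ico (τ + 1) M) (levelCard a) (m + 1)
        (fun t ht => by
          simp only [Finset.mem_Ico] at ht
          have := hlev t t t t (by omega) (by omega) (by omega) (by omega) (by omega)
          omega)
      simpa using this
    have h3 := Finset.sum_range_add_sum_Ico (levelCard a) (show τ + 1 ≤ M by omega)
    obtain ⟨e, he⟩ : ∃ e, M = τ + 1 + e := ⟨M - (τ + 1), by omega⟩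
    have h4 : M - (τ + 1) = e := by omega
    rw [h4] at h2
    rw [← hMdef]
    have h5 : 2 * (m * N) ≤ (τ + 1) * (2 * m + 2) + 2 * (e * (m + 1)) := by omega
    rw [he]
    nlinarith
  · left
    intro i
    refine (hmax i).trans ?_
    rcases Nat.lt_or_ge (2 * M) (τ + 2) with h | h
    · have : N = (4 * m + 3) * N' := by rw [hN, hp]
      nlinarith
    · have h1 : 2 * ∑ t ∈ Finset.Ico (τ + 1 - M) M, levelCard a t ≤
          (M - (τ + 1 - M)) * (2 * m + 2) := by
        have := two_mul_sum_le_of_involution (Finset.Ico (τ + 1 - M) M) (fun t => τ - t)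
          (levelCard a)
          (2 * m + 2) (fun x hx => by simp at hx ⊢; omega) (fun x hx => by simp at hx; omega)
          (fun x hx => by
            simp only [Finset.mem_Ico] at hx
            exact hpair x (by omega) (by omega) (by omega))
        simpa using this
      have h2 : ∑ t ∈ Finset.range (τ + 1 - M), levelCard a t ≤ (τ + 1 - M) * p := by
        have := Finset.sum_le_card_nsmul (Finset.range (τ + 1 - M)) (levelCard a) p
          (fun t _ => hlp t)
        simpa using this
      have h3 := Finset.sum_range_add_sum_Ico (levelCard a) (show τ + 1 - M ≤ M by omega)
      obtain ⟨e, he⟩ : ∃ e, τ + 1 = M + e := ⟨τ + 1 - M, by omega⟩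
      obtain ⟨f, hf⟩ : ∃ f, M = e + f := ⟨M - e, by omega⟩
      have h4 : τ + 1 - M = e := by omega
      have h5 : M - e = f := by omega
      rw [h4] at h1 h2 h3
      rw [h5] at h1
      have h6 : 2 * (m * N) ≤ 2 * (e * p) + f * (2 * m + 2) := by omega
      have h7 : N = (4 * m + 3) * N' := by rw [hN, hp]
      have h8 : 4 * e + 2 * f + 1 = (4 * m + 5) * N' := by
        have : (4 * m + 5) * N' = N + 2 * N' := by rw [h7]; ring
        omega
      rw [h7, hp] at h6
      rw [hf]
      nlinarith

lemma sum_stdAddChar_dotProduct {p n : ℕ} [Fact p.Prime] (x : Fin n → ZMod p) :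
    ∑ u : Fin n → ZMod p, (ZMod.stdAddChar (u ⬝ᵥ x) : ℂ) = if x = 0 then (p : ℂ) ^ n else 0 := by
  split_ifs with hx
  · subst hx
    simp [ZMod.card]
  · obtain ⟨i, hi⟩ := Function.ne_iff.1 hx
    let f : (Fin n → ZMod p) →+ ZMod p :=
      AddMonoidHom.mk' (fun u => u ⬝ᵥ x) (fun u v => add_dotProduct u v x)
    have h := AddChar.sum_eq_zero_of_ne_one
      (ψ := (ZMod.stdAddChar (N := p)).compAddMonoidHom f) (fun h1 => by
        have h2 : (ZMod.stdAddChar (N := p)) (f (Pi.single i (x i)⁻¹)) = 1 := by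
          have := DFunLike.congr_fun h1 (Pi.single i (x i)⁻¹)
          simpa using this
        have h3 : f (Pi.single i (x i)⁻¹) = 1 := by
          change (Pi.single i (x i)⁻¹) ⬝ᵥ x = 1
          rw [single_dotProduct]
          exact inv_mul_cancel₀ hi
        rw [h3] at h2
        have h4 : (ZMod.stdAddChar (N := p)) 1 = ZMod.stdAddChar (N := p) 0 := by rw [h2]; simp
        exact one_ne_zero (ZMod.injective_stdAddChar h4))
    exact h

lemma norm_sum_stdAddChar_le {p n c : ℕ} [Fact p.Prime] (A : Finset (Fin n → ZMod p))
    (u : Fin n → ZMod p) (h : ∀ i, (A.filter (fun x => u ⬝ᵥ x = i)).card ≤ c) :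
    ‖∑ x ∈ A, (ZMod.stdAddChar (u ⬝ᵥ x) : ℂ)‖ ≤ p * c - A.card := by
  have h1 : ∑ x ∈ A, (ZMod.stdAddChar (u ⬝ᵥ x) : ℂ) =
      ∑ i : ZMod p, ((A.filter (fun x => u ⬝ᵥ x = i)).card : ℂ) * ZMod.stdAddChar i := by
    rw [← Finset.sum_fiberwise A (fun x => u ⬝ᵥ x)]
    refine Finset.sum_congr rfl fun i _ => ?_
    rw [Finset.sum_congr rfl (g := fun _ => (ZMod.stdAddChar i : ℂ))
      (fun x hx => by rw [(Finset.mem_filter.1 hx).2])]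
    simp
  have h2 : ∑ i : ZMod p, (ZMod.stdAddChar i : ℂ) = 0 :=
    AddChar.sum_eq_zero_of_ne_one (fun h1 => by
      have h4 : (ZMod.stdAddChar (N := p)) 1 = ZMod.stdAddChar (N := p) 0 := by rw [h1]; simp
      exact one_ne_zero (ZMod.injective_stdAddChar h4))
  have h3 : ∑ x ∈ A, (ZMod.stdAddChar (u ⬝ᵥ x) : ℂ) =
      -∑ i : ZMod p, (((c : ℝ) - (A.filter (fun x => u ⬝ᵥ x = i)).card : ℝ) : ℂ) *
        ZMod.stdAddChar i := by
    rw [h1]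
    have : ∀ i : ZMod p, (((c : ℝ) - (A.filter (fun x => u ⬝ᵥ x = i)).card : ℝ) : ℂ) *
        ZMod.stdAddChar i = c * ZMod.stdAddChar i -
          ((A.filter (fun x => u ⬝ᵥ x = i)).card : ℂ) * ZMod.stdAddChar i := by
      intro i; push_cast; ring
    rw [Finset.sum_congr rfl (fun i _ => this i), Finset.sum_sub_distrib, ← Finset.mul_sum, h2]
    simp
  have h4 : ∑ i : ZMod p, ((A.filter (fun x => u ⬝ᵥ x = i)).card : ℝ) = A.card := by
    rw [Finset.card_eq_sum_card_fiberwise (f := fun x => u ⬝ᵥ x) (t := Finset.univ)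
      (fun _ _ => Finset.mem_coe.2 (Finset.mem_univ _))]
    push_cast
    rfl
  rw [h3, norm_neg]
  calc _ ≤ ∑ i : ZMod p, ‖(((c : ℝ) - (A.filter (fun x => u ⬝ᵥ x = i)).card : ℝ) : ℂ) *
        ZMod.stdAddChar i‖ := norm_sum_le _ _
    _ = ∑ i : ZMod p, ((c : ℝ) - (A.filter (fun x => u ⬝ᵥ x = i)).card) := by
        refine Finset.sum_congr rfl fun i _ => ?_
        rw [norm_mul, AddChar.norm_apply, mul_one, Complex.norm_real, Real.norm_of_nonneg]
        have := h i
        rw [sub_nonneg]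
        exact_mod_cast this
    _ = p * c - A.card := by
        rw [Finset.sum_sub_distrib, h4]
        simp [ZMod.card]

lemma sum_fourier_pow_four_eq_zero {p n : ℕ} [Fact p.Prime] (A : Finset (Fin n → ZMod p))
    (hA : ∀ a ∈ A, ∀ b ∈ A, ∀ c ∈ A, a + b + c ∉ A) :
    ∑ u : Fin n → ZMod p, (∑ x ∈ A, (ZMod.stdAddChar (u ⬝ᵥ x) : ℂ)) ^ 3 *
      (∑ x ∈ A, (ZMod.stdAddChar (u ⬝ᵥ (-x)) : ℂ)) = 0 := by
  have h1 : ∀ u : Fin n → ZMod p, (∑ x ∈ A, (ZMod.stdAddChar (u ⬝ᵥ x) : ℂ)) ^ 3 *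
      (∑ x ∈ A, (ZMod.stdAddChar (u ⬝ᵥ (-x)) : ℂ)) =
      ∑ a ∈ A, ∑ b ∈ A, ∑ c ∈ A, ∑ d ∈ A, (ZMod.stdAddChar (u ⬝ᵥ (a + b + c + -d)) : ℂ) := by
    intro u
    simp only [dotProduct_add, AddChar.map_add_eq_mul]
    simp only [← Finset.mul_sum, ← Finset.sum_mul]
    ring
  rw [Finset.sum_congr rfl (fun u _ => h1 u), Finset.sum_comm]
  refine Finset.sum_eq_zero fun a ha => ?_
  rw [Finset.sum_comm]
  refine Finset.sum_eq_zero fun b hb => ?_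
  rw [Finset.sum_comm]
  refine Finset.sum_eq_zero fun c hc => ?_
  rw [Finset.sum_comm]
  refine Finset.sum_eq_zero fun d hd => ?_
  rw [sum_stdAddChar_dotProduct, if_neg]
  intro h
  apply hA a ha b hb c hc
  rwa [show a + b + c = d from add_neg_eq_zero.1 h]

lemma stdAddChar_sum_neg {p n : ℕ} [Fact p.Prime] (A : Finset (Fin n → ZMod p))
    (u : Fin n → ZMod p) :
    ∑ x ∈ A, (ZMod.stdAddChar (u ⬝ᵥ (-x)) : ℂ) =
      (starRingEnd ℂ) (∑ x ∈ A, (ZMod.stdAddChar (u ⬝ᵥ x) : ℂ)) := by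
  rw [map_sum]
  refine Finset.sum_congr rfl fun x _ => ?_
  rw [dotProduct_neg, AddChar.map_neg_eq_conj]

lemma sum_norm_sq_fourier {p n : ℕ} [Fact p.Prime] (A : Finset (Fin n → ZMod p)) :
    ∑ u : Fin n → ZMod p, ‖∑ x ∈ A, (ZMod.stdAddChar (u ⬝ᵥ x) : ℂ)‖ ^ 2 =
      (p : ℝ) ^ n * A.card := by
  have h1 : ∀ u : Fin n → ZMod p,
      ((‖∑ x ∈ A, (ZMod.stdAddChar (u ⬝ᵥ x) : ℂ)‖ ^ 2 : ℝ) : ℂ) =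
      ∑ a ∈ A, ∑ b ∈ A, (ZMod.stdAddChar (u ⬝ᵥ (a + -b)) : ℂ) := by
    intro u
    rw [Complex.ofReal_pow, ← Complex.mul_conj', ← stdAddChar_sum_neg, Finset.sum_mul_sum]
    simp only [dotProduct_add, AddChar.map_add_eq_mul]
  have h2 : ((∑ u : Fin n → ZMod p, ‖∑ x ∈ A, (ZMod.stdAddChar (u ⬝ᵥ x) : ℂ)‖ ^ 2 : ℝ) : ℂ) =
      (p : ℂ) ^ n * A.card := by
    rw [Complex.ofReal_sum, Finset.sum_congr rfl (fun u _ => h1 u), Finset.sum_comm]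
    rw [Finset.sum_congr rfl (g := fun _ => (p : ℂ) ^ n)]
    · simp [mul_comm]
    · intro a ha
      rw [Finset.sum_comm]
      simp only [sum_stdAddChar_dotProduct]
      rw [Finset.sum_eq_single a]
      · simp
      · intro b _ hb
        rw [if_neg]
        rw [add_neg_eq_zero]
        exact fun h => hb h.symm
      · exact fun h => absurd ha h
  exact_mod_cast h2

/-- Some linear functional has a fibre on which `A` is unusually dense. -/
lemma exists_dense_fiber {p m n N' : ℕ} [Fact p.Prime] (hp : p = 4 * m + 3) (hm : 9 ≤ m)
    (hn : p ^ n = p * (p * N')) (A : Finset (Fin n → ZMod p))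
    (hA : ∀ a ∈ A, ∀ b ∈ A, ∀ c ∈ A, a + b + c ∉ A) (hcard : m * (p * N') ≤ A.card) :
    ∃ u : Fin n → ZMod p, u ≠ 0 ∧ ∃ i, (m + 4) * N' < (A.filter (fun x => u ⬝ᵥ x = i)).card := by
  by_contra! h
  set F : (Fin n → ZMod p) → ℂ := fun u => ∑ x ∈ A, (ZMod.stdAddChar (u ⬝ᵥ x) : ℂ) with hF
  have hp0 : 0 < p := by omega
  have hN' : 0 < N' := by
    rcases Nat.eq_zero_or_pos N' with h | h
    · subst h
      have : 0 < p ^ n := by positivity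
      omega
    · exact h
  have hb : ∀ u, u ≠ 0 → ‖F u‖ ≤ 4 * (p * N') := by
    intro u hu
    have h1 := norm_sum_stdAddChar_le A u (h u hu)
    have h2 : (m * (p * N') : ℝ) ≤ A.card := by exact_mod_cast hcard
    push_cast at h1
    refine h1.trans ?_
    nlinarith
  have h4 := sum_fourier_pow_four_eq_zero A hA
  simp only [stdAddChar_sum_neg] at h4
  have h0 : F 0 = A.card := by simp [hF]
  rw [← Finset.add_sum_erase _ _ (Finset.mem_univ 0)] at h4
  change F 0 ^ 3 * (starRingEnd ℂ) (F 0) +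
    ∑ u ∈ Finset.univ.erase 0, F u ^ 3 * (starRingEnd ℂ) (F u) = 0 at h4
  have h5 : ‖F 0 ^ 3 * (starRingEnd ℂ) (F 0)‖ ≤
      ∑ u ∈ Finset.univ.erase 0, (4 * (p * N') : ℝ) ^ 2 * ‖F u‖ ^ 2 := by
    rw [eq_neg_of_add_eq_zero_left h4, norm_neg]
    refine norm_sum_le_of_le _ fun u hu => ?_
    rw [norm_mul, norm_pow, RCLike.norm_conj]
    have h6 := pow_le_pow_left₀ (norm_nonneg _) (hb u (Finset.ne_of_mem_erase hu)) 2
    calc ‖F u‖ ^ 3 * ‖F u‖ = ‖F u‖ ^ 2 * ‖F u‖ ^ 2 := by ring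
      _ ≤ _ := mul_le_mul_of_nonneg_right h6 (by positivity)
  rw [h0, ← Finset.mul_sum] at h5
  have h6 : ∑ u ∈ Finset.univ.erase 0, ‖F u‖ ^ 2 ≤ (p : ℝ) ^ n * A.card := by
    rw [← sum_norm_sq_fourier A]
    exact Finset.sum_le_sum_of_subset_of_nonneg (Finset.erase_subset _ _)
      (fun _ _ _ => by positivity)
  have h7 : (A.card : ℝ) ^ 3 * A.card ≤ (4 * (p * N') : ℝ) ^ 2 * ((p : ℝ) ^ n * A.card) := by
    have h8 : ‖(A.card : ℂ) ^ 3 * (starRingEnd ℂ) (A.card : ℂ)‖ = (A.card : ℝ) ^ 3 * A.card := by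
      simp
    rw [h8] at h5
    exact h5.trans (mul_le_mul_of_nonneg_left h6 (by positivity))
  have h8 : A.card ^ 3 * A.card ≤ (4 * (p * N')) ^ 2 * (p ^ n * A.card) := by exact_mod_cast h7
  have hpos : 0 < p * N' := by positivity
  have hApos : 0 < A.card := lt_of_lt_of_le (Nat.mul_pos (by omega) hpos) hcard
  have h9 : A.card ^ 3 ≤ (4 * (p * N')) ^ 2 * p ^ n :=
    Nat.le_of_mul_le_mul_right (by rw [mul_assoc]; exact h8) hApos
  have h10 : (m * (p * N')) ^ 3 ≤ (4 * (p * N')) ^ 2 * p ^ n :=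
    (Nat.pow_le_pow_left hcard 3).trans h9
  have h11 : m ^ 3 ≤ 16 * p := by
    refine le_of_mul_le_mul_right (a := (p * N') ^ 3) ?_ (pow_pos hpos 3)
    calc m ^ 3 * (p * N') ^ 3 = (m * (p * N')) ^ 3 := by ring
      _ ≤ _ := h10
      _ = _ := by rw [hn]; ring
  rw [hp] at h11
  nlinarith [Nat.mul_le_mul hm hm]

/-- A family of layers indexed by `ZMod p` that comes from a `(3,1)`-sum-free set. -/
def LayerFree {p : ℕ} {K : Type*} [AddCommGroup K] (X : ZMod p → Finset K) : Prop :=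
  ∀ i j k, ∀ x ∈ X i, ∀ y ∈ X j, ∀ z ∈ X k, x + y + z ∉ X (i + j + k)

/-- Indices of nonempty layers. -/
def layerSupp {p : ℕ} [NeZero p] {K : Type*} (X : ZMod p → Finset K) : Finset (ZMod p) :=
  Finset.univ.filter (fun i => 0 < (X i).card)

lemma mem_layerSupp {p : ℕ} [NeZero p] {K : Type*} {X : ZMod p → Finset K} {i : ZMod p} :
    i ∈ layerSupp X ↔ (X i).Nonempty := by
  simp [layerSupp, Finset.card_pos]

section
variable {p : ℕ} [Fact p.Prime] {K : Type*} [AddCommGroup K] [Fintype K] [DecidableEq K]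
  {X : ZMod p → Finset K}

lemma LayerFree.not_mem_layerSupp (hX : LayerFree X) {i j k : ZMod p}
    (hij : Fintype.card K < (X i).card + (X j).card) (hk : k ∈ layerSupp X) :
    i + j + k ∉ layerSupp X := by
  intro h
  rw [mem_layerSupp] at h hk
  obtain ⟨w, hw⟩ := h
  obtain ⟨z, hz⟩ := hk
  obtain ⟨x, hx, y, hy, hxy⟩ := exists_add_eq_of_card_lt _ _ hij (w - z)
  exact hX i j k x hx y hy z hz (by rw [hxy]; simpa using hw)

lemma LayerFree.card_layerSupp_le {m : ℕ} (hp : p = 4 * m + 3) (hm : 3 ≤ m) (hX : LayerFree X)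
    (hsum : m * Fintype.card K ≤ ∑ i, (X i).card)
    (hbig : ∃ i, m * Fintype.card K ≤ (m + 1) * (X i).card) :
    (layerSupp X).card ≤ m + 2 := by
  set a : ZMod p → ℕ := fun i => (X i).card with ha
  set N := Fintype.card K with hN
  obtain ⟨i₀, -, hmax⟩ := Finset.exists_max_image (Finset.univ : Finset (ZMod p)) a
    ⟨0, Finset.mem_univ _⟩
  replace hmax : ∀ i, a i ≤ a i₀ := fun i => hmax i (Finset.mem_univ _)
  obtain ⟨i₁, hi₁⟩ := hbig
  have hM1 : m * N ≤ (m + 1) * a i₀ := hi₁.trans (Nat.mul_le_mul_left _ (hmax i₁))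
  have hMN : a i₀ ≤ N := Finset.card_le_univ _
  have hNpos : 0 < N := Fintype.card_pos
  have hpair : ∀ t t', t < a i₀ → t' < a i₀ → N ≤ t + t' + 1 →
      levelCard a t + levelCard a t' + 2 * (layerSupp X).card ≤ p + 2 := by
    intro t t' ht ht' h
    have := levelCard_add_le a i₀ t t' 0 0 ht ht' (by omega) (by omega) (by
      intro i j k hi hj hk hl
      have := hX.not_mem_layerSupp (i := i) (j := j) (k := k) (by simp only [ha] at *; omega)
        (Finset.mem_filter.2 ⟨Finset.mem_univ _, hk⟩)
      exact this (Finset.mem_filter.2 ⟨Finset.mem_univ _, hl⟩))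
    have h2 : levelCard a 0 = (layerSupp X).card := rfl
    omega
  have hlevle : ∀ t, levelCard a t ≤ (layerSupp X).card := fun t => levelCard_anti a (Nat.zero_le t)
  change m * N ≤ ∑ i, a i at hsum
  rw [sum_eq_sum_levelCard a (a i₀) hmax] at hsum
  set M := a i₀
  set s := (layerSupp X).card
  obtain ⟨e, he⟩ : ∃ e, N = M + e := ⟨N - M, by omega⟩
  have h2M : e < M := by
    by_contra! h
    nlinarith
  obtain ⟨f, hf⟩ : ∃ f, M = e + f := ⟨M - e, by omega⟩
  by_contra! hs
  obtain ⟨r, hr⟩ : ∃ r, s = m + 3 + r := ⟨s - (m + 3), by omega⟩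
  have h1 : 2 * ∑ t ∈ Finset.Ico e M, levelCard a t ≤ f * (p + 2 - 2 * s) := by
    have := two_mul_sum_le_of_involution (Finset.Ico e M) (fun t => N - 1 - t) (levelCard a)
      (p + 2 - 2 * s) (fun x hx => by simp at hx ⊢; omega) (fun x hx => by simp at hx; omega)
      (fun x hx => by
        simp only [Finset.mem_Ico] at hx
        have := hpair x (N - 1 - x) (by omega) (by omega) (by omega)
        omega)
    simpa [hf] using this
  have h2 : ∑ t ∈ Finset.range e, levelCard a t ≤ e * s := by
    have := Finset.sum_le_card_nsmul (Finset.range e) (levelCard a) s (fun t _ => hlevle t)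
    simpa using this
  have h3 := Finset.sum_range_add_sum_Ico (levelCard a) (show e ≤ M by omega)
  have hs2 := hpair (M - 1) (M - 1) (by omega) (by omega) (by omega)
  obtain ⟨g, hg⟩ : ∃ g, p + 2 = 2 * s + g := ⟨p + 2 - 2 * s, by omega⟩
  have h4 : p + 2 - 2 * s = g := by omega
  rw [h4] at h1
  have h5 : 2 * (m * N) ≤ 2 * (e * s) + f * g := by omega
  have hg' : (g : ℤ) = 2 * m - 1 - 2 * r := by omega
  zify at h5 hM1
  rw [hg'] at h5
  have hNe : (N : ℤ) = 2 * e + f := by omega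
  have hMe : (M : ℤ) = e + f := by omega
  have hse : (s : ℤ) = m + 3 + r := by omega
  rw [hNe] at h5 hM1
  rw [hMe] at hM1
  rw [hse] at h5
  have hf1 : (m - 1 : ℤ) * e ≤ f := by nlinarith
  have hfe : (e : ℤ) ≤ f := by nlinarith
  have hfpos : (0 : ℤ) < f := by omega
  have hme : (3 : ℤ) * e ≤ m * e := by gcongr; exact_mod_cast hm
  have hr0 : (0 : ℤ) ≤ r * (f - e) := mul_nonneg (by positivity) (by linarith)
  nlinarith

end

/-- `B` is an arithmetic progression of difference `d`, in terms of its number of `d`-gaps. -/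
def IsStep {p : ℕ} (d : ZMod p) (B : Finset (ZMod p)) : Prop :=
  (B + {0, d}).card ≤ B.card + 1

section
variable {p : ℕ} [Fact p.Prime] {A B : Finset (ZMod p)} {d : ZMod p}

lemma add_pair_eq_union (B : Finset (ZMod p)) (d : ZMod p) : B + {0, d} = B ∪ (d +ᵥ B) := by
  ext x
  simp only [Finset.mem_add, Finset.mem_insert, Finset.mem_singleton, Finset.mem_union,
    Finset.mem_vadd_finset, vadd_eq_add]
  constructor
  · rintro ⟨b, hb, c, rfl | rfl, rfl⟩
    · left; simpa using hb
    · right; exact ⟨b, hb, add_comm _ _⟩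
  · rintro (h | ⟨b, hb, rfl⟩)
    · exact ⟨x, h, 0, Or.inl rfl, add_zero x⟩
    · exact ⟨b, hb, d, Or.inr rfl, add_comm _ _⟩

lemma card_filter_add_mem (A : Finset (ZMod p)) (d : ZMod p) :
    (A + {0, d}).card + (A.filter (fun a => a + d ∈ A)).card = 2 * A.card := by
  have h1 : (A ∩ (d +ᵥ A)).card = (A.filter (fun a => a + d ∈ A)).card := by
    rw [← Finset.card_vadd_finset d (A.filter (fun a => a + d ∈ A))]
    congr 1
    ext x
    simp only [Finset.mem_inter, Finset.mem_vadd_finset, vadd_eq_add, Finset.mem_filter]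
    constructor
    · rintro ⟨h, b, hb, rfl⟩
      exact ⟨b, ⟨hb, by rwa [add_comm]⟩, rfl⟩
    · rintro ⟨b, ⟨hb, hbd⟩, rfl⟩
      exact ⟨by rwa [add_comm], b, hb, rfl⟩
  rw [add_pair_eq_union, ← h1, Finset.card_union_add_card_inter, Finset.card_vadd_finset]
  ring

lemma cauchy_davenport_of_lt (hA : A.Nonempty) (hB : B.Nonempty) (h : (A + B).card < p) :
    A.card + B.card ≤ (A + B).card + 1 := by
  have := ZMod.cauchy_davenport (Fact.out : p.Prime) hA hB
  omega

lemma IsStep.of_add (hA : IsStep d A) (hA2 : 2 ≤ A.card) (hB : B.Nonempty)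
    (h : (A + B).card + 1 ≤ A.card + B.card) (hlt : (A + B).card < p) : IsStep d B := by
  have h1 := card_filter_add_mem A d
  unfold IsStep at hA ⊢
  set A' := A.filter (fun a => a + d ∈ A) with hA'
  have h2 : A' + (B + {0, d}) ⊆ A + B := by
    intro x hx
    obtain ⟨a, ha, y, hy, rfl⟩ := Finset.mem_add.1 hx
    obtain ⟨b, hb, c, hc, rfl⟩ := Finset.mem_add.1 hy
    rw [hA', Finset.mem_filter] at ha
    simp only [Finset.mem_insert, Finset.mem_singleton] at hc
    rcases hc with rfl | rfl
    · exact Finset.mem_add.2 ⟨a, ha.1, b, hb, by ring⟩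
    · exact Finset.mem_add.2 ⟨a + c, ha.2, b, hb, by ring⟩
  have h3 := Finset.card_le_card h2
  have h4 := cauchy_davenport_of_lt (A := A') (B := B + {0, d})
    (Finset.card_pos.1 (by omega)) (hB.add ⟨0, by simp⟩) (by omega)
  omega

lemma IsStep.neg_compl (hA : IsStep d A) : IsStep d (-Aᶜ) := by
  have h1 := card_filter_add_mem A d
  have h2 := card_filter_add_mem (-Aᶜ) d
  unfold IsStep at hA ⊢
  have h3 : (-Aᶜ).filter (fun a => a + d ∈ -Aᶜ) = -(A + {0, d})ᶜ := by
    ext x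
    simp only [Finset.mem_filter, Finset.mem_neg', Finset.mem_compl,
      add_pair_eq_union, Finset.mem_union, Finset.mem_vadd_finset, vadd_eq_add]
    constructor
    · rintro ⟨h1, h2⟩
      rintro (h | ⟨b, hb, h⟩)
      · exact h1 h
      · apply h2
        rw [show -(x + d) = b by rw [neg_add, ← h]; ring]
        exact hb
    · intro h
      push Not at h
      refine ⟨h.1, fun h4 => h.2 _ h4 (by ring)⟩
  rw [h3] at h2
  simp only [Finset.card_neg, Finset.card_compl, ZMod.card] at h2 ⊢
  have h4 := Finset.card_le_univ A
  have h5 := Finset.card_le_univ (A + {0, d})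
  rw [ZMod.card] at h4 h5
  omega

lemma IsStep.of_isStep_add (hAB : IsStep d (A + B)) (hA : A.Nonempty) (hB2 : 2 ≤ B.card)
    (h : (A + B).card + 1 = A.card + B.card) (hlt : (A + B).card + 2 ≤ p) : IsStep d A := by
  have h1 := hAB.neg_compl
  have hsub : -(A + B)ᶜ + A ⊆ -Bᶜ := by
    intro x hx
    obtain ⟨c, hc, a, ha, rfl⟩ := Finset.mem_add.1 hx
    rw [Finset.mem_neg', Finset.mem_compl] at hc ⊢
    intro hb
    apply hc
    exact Finset.mem_add.2 ⟨a, ha, _, hb, by ring⟩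
  have h2 := Finset.card_le_card hsub
  have h3 := Finset.card_le_univ (A + B)
  have h4 := Finset.card_le_univ B
  have h5 : (-(A + B)ᶜ).card = p - (A + B).card := by
    rw [Finset.card_neg, Finset.card_compl, ZMod.card]
  have h6 : (-Bᶜ).card = p - B.card := by
    rw [Finset.card_neg, Finset.card_compl, ZMod.card]
  rw [ZMod.card] at h3 h4
  exact h1.of_add (by omega) hA (by omega) (by omega)

lemma IsStep.add (hA : IsStep d A) (hA2 : 2 ≤ A.card) (hB : B.Nonempty)
    (h : (A + B).card + 1 = A.card + B.card) (hlt : (A + B).card + 1 ≤ p) : IsStep d (A + B) := by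
  have hsub : A + -(A + B)ᶜ ⊆ -Bᶜ := by
    intro x hx
    obtain ⟨a, ha, c, hc, rfl⟩ := Finset.mem_add.1 hx
    rw [Finset.mem_neg', Finset.mem_compl] at hc ⊢
    intro hb
    apply hc
    exact Finset.mem_add.2 ⟨a, ha, _, hb, by ring⟩
  have h2 := Finset.card_le_card hsub
  have h3 := Finset.card_le_univ (A + B)
  have h4 := Finset.card_le_univ B
  have h5 : (-(A + B)ᶜ).card = p - (A + B).card := by
    rw [Finset.card_neg, Finset.card_compl, ZMod.card]
  have h6 : (-Bᶜ).card = p - B.card := by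
    rw [Finset.card_neg, Finset.card_compl, ZMod.card]
  rw [ZMod.card] at h3 h4
  have h7 := Finset.card_pos.2 hB
  have h8 := (hA.of_add hA2 (B := -(A + B)ᶜ) (Finset.card_pos.1 (by omega)) (by omega)
    (by omega)).neg_compl
  have h9 : -(-(A + B)ᶜ)ᶜ = A + B := by
    ext x
    simp [Finset.mem_neg']
  rwa [h9] at h8

lemma isStep_pair (b : ZMod p) (hd : d ≠ 0) : IsStep d {b, b + d} := by
  have h1 := card_filter_add_mem {b, b + d} d
  unfold IsStep
  have : b ∈ ({b, b + d} : Finset (ZMod p)).filter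
      (fun a => a + d ∈ ({b, b + d} : Finset (ZMod p))) := by
    simp
  have := Finset.card_pos.2 ⟨b, this⟩
  have : ({b, b + d} : Finset (ZMod p)).card = 2 := Finset.card_pair (by simpa using hd)
  omega

/-- Vosper's theorem, conclusion for the first summand only. -/
lemma vosper_left (A B : Finset (ZMod p)) (hA : 2 ≤ A.card) (hB : 2 ≤ B.card)
    (h : (A + B).card + 1 = A.card + B.card) (hlt : (A + B).card + 2 ≤ p) :
    ∃ d, d ≠ 0 ∧ IsStep d A := by
  suffices H : ∀ n, ∀ A B : Finset (ZMod p), B.card = n → (0 : ZMod p) ∈ B → 2 ≤ A.card →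
      2 ≤ B.card → (A + B).card + 1 = A.card + B.card → (A + B).card + 2 ≤ p →
      ∃ d, d ≠ 0 ∧ IsStep d A by
    obtain ⟨b, hb⟩ : B.Nonempty := Finset.card_pos.1 (by omega)
    have h1 : (-b +ᵥ B).card = B.card := Finset.card_vadd_finset _ _
    have h2 : (A + (-b +ᵥ B)).card = (A + B).card := by
      rw [show A + (-b +ᵥ B) = -b +ᵥ (A + B) by rw [add_vadd_comm], Finset.card_vadd_finset]
    exact H _ A (-b +ᵥ B) rfl
      (Finset.mem_vadd_finset.2 ⟨b, hb, by simp⟩) hA (by omega) (by omega) (by omega)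
  intro n
  induction n using Nat.strong_induction_on with
  | _ n ih =>
  intro A B hn h0 hA hB h hlt
  have hAne : A.Nonempty := Finset.card_pos.1 (by omega)
  by_cases hB3 : B.card = 2
  · obtain ⟨x, y, hxy, rfl⟩ := Finset.card_eq_two.1 hB3
    have h1 : IsStep (y - x) {x, y} := by
      have := isStep_pair x (d := y - x) (sub_ne_zero.2 hxy.symm)
      rwa [add_sub_cancel] at this
    rw [add_comm A] at h hlt
    exact ⟨y - x, sub_ne_zero.2 hxy.symm, h1.of_add hB hAne (by omega) (by omega)⟩
  by_cases hex : ∃ e ∈ A, 2 ≤ (B.filter (fun b => e + b ∈ A)).card ∧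
      (B.filter (fun b => e + b ∈ A)).card < B.card
  · obtain ⟨e, he, h2, h3⟩ := hex
    set B' := B.filter (fun b => e + b ∈ A) with hB'
    set A' := A ∪ (e +ᵥ B) with hA'
    have hcard : A'.card + B'.card = A.card + B.card := by
      have h4 : B'.card = (A ∩ (e +ᵥ B)).card := by
        rw [← Finset.card_vadd_finset e B']
        congr 1
        ext x
        simp only [hB', Finset.mem_inter, Finset.mem_vadd_finset, vadd_eq_add, Finset.mem_filter]
        constructor
        · rintro ⟨b, ⟨hb, hbd⟩, rfl⟩
          exact ⟨hbd, b, hb, rfl⟩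
        · rintro ⟨h, b, hb, rfl⟩
          exact ⟨b, ⟨hb, h⟩, rfl⟩
      rw [h4, hA', Finset.card_union_add_card_inter, Finset.card_vadd_finset]
    have hsub : A' + B' ⊆ A + B := by
      intro x hx
      obtain ⟨a, ha, b, hb, rfl⟩ := Finset.mem_add.1 hx
      rw [hB', Finset.mem_filter] at hb
      rcases Finset.mem_union.1 ha with ha | ha
      · exact Finset.add_mem_add ha hb.1
      · obtain ⟨c, hc, rfl⟩ := Finset.mem_vadd_finset.1 ha
        exact Finset.mem_add.2 ⟨e + b, hb.2, c, hc, by rw [vadd_eq_add]; ring⟩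
    have hA'2 : A.card ≤ A'.card := Finset.card_le_card Finset.subset_union_left
    have h5 := Finset.card_le_card hsub
    have h6 := cauchy_davenport_of_lt (A := A') (B := B') (Finset.card_pos.1 (by omega))
      (Finset.card_pos.1 (by omega)) (by omega)
    have h7 : A' + B' = A + B := Finset.eq_of_subset_of_card_le hsub (by omega)
    obtain ⟨d, hd, hd1⟩ := ih B'.card (by omega) A' B' rfl
      (by rw [hB', Finset.mem_filter]; exact ⟨h0, by simpa using he⟩) (by omega) h2
      (by omega) (by omega)
    have h8 := hd1.add (by omega) (B := B') (Finset.card_pos.1 (by omega)) (by omega) (by omega)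
    rw [h7] at h8
    exact ⟨d, hd, h8.of_isStep_add hAne hB h hlt⟩
  · exfalso
    push Not at hex
    set E := A.filter (fun e => ∀ b ∈ B, e + b ∈ A) with hE
    set F := A.filter (fun e => ¬ ∀ b ∈ B, e + b ∈ A) with hF
    have hEF : E.card + F.card = A.card := Finset.card_filter_add_card_filter_not _
    have hB0 : (B.erase 0).card + 1 = B.card := Finset.card_erase_add_one h0
    have hFle : F.card ≤ 1 := by
      by_contra! hF2
      have hsub : F + B.erase 0 ⊆ (A + B) \ A := by
        intro x hx
        obtain ⟨f, hf, b, hb, rfl⟩ := Finset.mem_add.1 hx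
        rw [hF, Finset.mem_filter] at hf
        rw [Finset.mem_erase] at hb
        refine Finset.mem_sdiff.2 ⟨Finset.add_mem_add hf.1 hb.2, fun hfb => ?_⟩
        have h1 : ({0, b} : Finset (ZMod p)) ⊆ B.filter (fun b => f + b ∈ A) := by
          intro y hy
          rw [Finset.mem_insert, Finset.mem_singleton] at hy
          rcases hy with rfl | rfl
          · exact Finset.mem_filter.2 ⟨h0, by simpa using hf.1⟩
          · exact Finset.mem_filter.2 ⟨hb.2, hfb⟩
        have h2 := Finset.card_le_card h1
        rw [Finset.card_pair hb.1.symm] at h2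
        have h3 := hex f hf.1 h2
        have h4 := Finset.eq_of_subset_of_card_le (Finset.filter_subset _ _) h3
        apply hf.2
        intro b hb
        rw [← h4, Finset.mem_filter] at hb
        exact hb.2
      have h1 := Finset.card_le_card hsub
      have h2 : A ⊆ A + B := fun a ha => Finset.mem_add.2 ⟨a, ha, 0, h0, add_zero a⟩
      rw [Finset.card_sdiff_of_subset h2] at h1
      have h3 := Finset.card_le_card h2
      have h4 := cauchy_davenport_of_lt (A := F) (B := B.erase 0) (Finset.card_pos.1 (by omega))
        (Finset.card_pos.1 (by omega)) (by omega)
      omega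
    have hsub : E + B ⊆ A := by
      intro x hx
      obtain ⟨e, he, b, hb, rfl⟩ := Finset.mem_add.1 hx
      exact (Finset.mem_filter.1 he).2 b hb
    have h1 := Finset.card_le_card hsub
    have h4 := cauchy_davenport_of_lt (A := E) (B := B) (Finset.card_pos.1 (by omega))
        (Finset.card_pos.1 (by omega)) (by omega)
    omega

/-- A set with at most one `d`-gap is an arithmetic progression. -/
lemma IsStep.exists_subset (hA : IsStep d A) (hd : d ≠ 0) (hne : A.Nonempty) :
    ∃ y : ZMod p, ∀ x ∈ A, ∃ i : ℕ, i < A.card ∧ x = y + i * d := by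
  have h1 := card_filter_add_mem A d
  unfold IsStep at hA
  have hgap : ∀ x ∈ A, ∀ y ∈ A, x + d ∉ A → y + d ∉ A → x = y := by
    intro x hx y hy hxd hyd
    by_contra hxy
    have h2 : A.filter (fun a => a + d ∈ A) ⊆ (A.erase x).erase y := by
      intro z hz
      rw [Finset.mem_filter] at hz
      refine Finset.mem_erase.2 ⟨?_, Finset.mem_erase.2 ⟨?_, hz.1⟩⟩
      · rintro rfl; exact hyd hz.2
      · rintro rfl; exact hxd hz.2
    have h3 := Finset.card_le_card h2
    have h4 : ((A.erase x).erase y).card + 1 = (A.erase x).card :=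
      Finset.card_erase_add_one (Finset.mem_erase.2 ⟨fun h => hxy h.symm, hy⟩)
    have h5 := Finset.card_erase_add_one hx
    omega
  obtain ⟨e, heA, he⟩ : ∃ e ∈ A, ∀ z ∈ A, z + d ∉ A → z = e := by
    by_cases h : ∃ e ∈ A, e + d ∉ A
    · obtain ⟨e, he, hed⟩ := h
      exact ⟨e, he, fun z hz hzd => hgap z hz e he hzd hed⟩
    · push Not at h
      obtain ⟨e, he⟩ := hne
      exact ⟨e, he, fun z hz hzd => absurd (h z hz) hzd⟩
  refine ⟨e - ((A.card - 1 : ℕ) : ZMod p) * d, fun x hx => ?_⟩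
  set j := ((e - x) / d).val with hj
  have hjp : j < p := ZMod.val_lt _
  have hjd : (j : ZMod p) * d = e - x := by
    rw [hj, ZMod.natCast_zmod_val, div_mul_cancel₀ _ hd]
  have hinj : ∀ i i' : ℕ, i < p → i' < p → (i : ZMod p) * d = i' * d → i = i' := by
    intro i i' hi hi' h
    have := mul_right_cancel₀ hd h
    rw [ZMod.natCast_eq_natCast_iff'] at this
    rwa [Nat.mod_eq_of_lt hi, Nat.mod_eq_of_lt hi'] at this
  have hmem : ∀ i : ℕ, i ≤ j → x + i * d ∈ A := by
    intro i
    induction i with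
    | zero => intro _; simpa using hx
    | succ i ih =>
      intro hij
      by_contra hnot
      have h2 := he _ (ih (by omega)) (by
        intro h; apply hnot
        push_cast
        rw [add_mul, one_mul, ← add_assoc]
        exact h)
      have h3 := hinj i j (by omega) hjp (by rw [hjd, ← h2]; ring)
      omega
  have hcard : j + 1 ≤ A.card := by
    have h2 : (Finset.range (j + 1)).image (fun i : ℕ => x + i * d) ⊆ A := by
      intro z hz
      obtain ⟨i, hi, rfl⟩ := Finset.mem_image.1 hz
      exact hmem i (by simpa [Nat.lt_succ_iff] using hi)
    have h3 := Finset.card_le_card h2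
    rw [Finset.card_image_of_injOn, Finset.card_range] at h3
    · exact h3
    · intro a ha b hb hab
      simp only [Finset.coe_range, Set.mem_Iio] at ha hb
      exact hinj a b (by omega) (by omega) (add_left_cancel hab)
  refine ⟨A.card - 1 - j, by omega, ?_⟩
  have h5 : ((A.card - 1 : ℕ) : ZMod p) = ((A.card - 1 - j : ℕ) : ZMod p) + j := by
    rw [← Nat.cast_add]; congr 1; omega
  rw [h5]
  linear_combination hjd

lemma odd_card_sub_self (hp2 : p ≠ 2) (hA : A.Nonempty) : Odd (A - A).card := by
  have h2 : (2 : ZMod p) ≠ 0 := by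
    intro h
    have h3 : ((2 : ℕ) : ZMod p) = 0 := by exact_mod_cast h
    rw [ZMod.natCast_eq_zero_iff] at h3
    exact hp2 ((Nat.prime_dvd_prime_iff_eq Fact.out Nat.prime_two).1 h3)
  have h0 : (0 : ZMod p) ∈ A - A := by
    obtain ⟨a, ha⟩ := hA
    exact Finset.mem_sub.2 ⟨a, ha, a, ha, sub_self a⟩
  have h1 : Even ((A - A).erase 0).card := by
    rw [Nat.even_iff]
    have := Finset.sum_involution (s := (A - A).erase 0) (f := fun _ => (1 : ZMod 2))
      (fun a _ => -a) (fun _ _ => by decide)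
      (fun a ha _ h => by
        apply Finset.ne_of_mem_erase ha
        have : (2 : ZMod p) * a = 0 := by linear_combination (-1 : ZMod p) * h
        exact (mul_eq_zero.1 this).resolve_left h2)
      (fun a ha => by
        rw [Finset.mem_erase] at ha ⊢
        refine ⟨neg_ne_zero.2 ha.1, ?_⟩
        obtain ⟨x, hx, y, hy, h⟩ := Finset.mem_sub.1 ha.2
        exact Finset.mem_sub.2 ⟨y, hy, x, hx, by rw [← h]; ring⟩)
      (fun a _ => neg_neg a)
    rw [Finset.sum_const, nsmul_eq_mul, mul_one, ZMod.natCast_eq_zero_iff] at this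
    omega
  rw [← Finset.card_erase_add_one h0]
  exact h1.add_one

/-- A set with `|S - S| ≤ 2|S|` is contained in an arithmetic progression of length `|S|`. -/
lemma exists_progression_of_card_sub_le (hp2 : p ≠ 2) (S : Finset (ZMod p)) (hS : 2 ≤ S.card)
    (h : (S - S).card ≤ 2 * S.card) (hlt : 2 * S.card + 1 ≤ p) :
    ∃ y d : ZMod p, d ≠ 0 ∧ ∀ x ∈ S, ∃ i : ℕ, i < S.card ∧ x = y + i * d := by
  have hne : S.Nonempty := Finset.card_pos.1 (by omega)
  have h1 := odd_card_sub_self hp2 hne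
  rw [Nat.odd_iff] at h1
  have h2 := cauchy_davenport_of_lt (A := S) (B := -S) hne hne.neg
  rw [← sub_eq_add_neg, Finset.card_neg] at h2
  have h3 := h2 (by omega)
  obtain ⟨d, hd, hstep⟩ := vosper_left S (-S) hS (by rwa [Finset.card_neg])
    (by rw [← sub_eq_add_neg, Finset.card_neg]; omega) (by rw [← sub_eq_add_neg]; omega)
  obtain ⟨y, hy⟩ := hstep.exists_subset hd hne
  exact ⟨y, d, hd, hy⟩

end

lemma exists_subset_card_eq_forall_le {α : Type*} [DecidableEq α] (S : Finset α) (f : α → ℕ)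
    (m : ℕ) (hm : m ≤ S.card) :
    ∃ B ⊆ S, B.card = m ∧ ∀ x ∈ S \ B, ∀ b ∈ B, f x ≤ f b := by
  induction m with
  | zero => exact ⟨∅, by simp, by simp, by simp⟩
  | succ m ih =>
    obtain ⟨B, hBS, hB, hmax⟩ := ih (by omega)
    have hne : (S \ B).Nonempty := by
      rw [← Finset.card_pos, Finset.card_sdiff_of_subset hBS]; omega
    obtain ⟨x, hx, hxmax⟩ := Finset.exists_max_image _ f hne
    rw [Finset.mem_sdiff] at hx
    refine ⟨insert x B, Finset.insert_subset hx.1 hBS, ?_, ?_⟩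
    · rw [Finset.card_insert_of_notMem hx.2, hB]
    · intro y hy b hb
      rw [Finset.mem_sdiff, Finset.mem_insert, not_or] at hy
      rcases Finset.mem_insert.1 hb with rfl | hb
      · exact hxmax y (Finset.mem_sdiff.2 ⟨hy.1, hy.2.2⟩)
      · exact hmax y (Finset.mem_sdiff.2 ⟨hy.1, hy.2.2⟩) b hb

section
variable {p : ℕ} [Fact p.Prime] {K : Type*} [AddCommGroup K] [Fintype K] [DecidableEq K]
  {X : ZMod p → Finset K}

omit [DecidableEq K] in
/-- The heaviest `m` layers pairwise have total weight exceeding that of the ambient group. -/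
lemma LayerFree.exists_heavy {m : ℕ} (hm : 2 ≤ m) (hodd : Odd (Fintype.card K))
    (hsum : m * Fintype.card K ≤ ∑ i, (X i).card) (hs : (layerSupp X).card ≤ m + 2) :
    m ≤ (layerSupp X).card ∧ ∃ B ⊆ layerSupp X, B.card = m ∧
      (∀ i ∈ B, ∀ j ∈ B, i ≠ j → Fintype.card K < (X i).card + (X j).card) ∧
      ((layerSupp X).card ≤ m + 1 → ∀ i ∈ B, Fintype.card K < (X i).card + (X i).card) := by
  set S := layerSupp X with hS
  set N := Fintype.card K with hN
  have hNpos : 0 < N := Fintype.card_pos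
  have hle : ∀ i, (X i).card ≤ N := fun i => Finset.card_le_univ _
  have hsumS : ∑ i, (X i).card = ∑ i ∈ S, (X i).card := by
    symm
    refine Finset.sum_subset (Finset.subset_univ _) fun i _ hi => ?_
    by_contra h
    exact hi (Finset.mem_filter.2 ⟨Finset.mem_univ _, Nat.pos_of_ne_zero h⟩)
  rw [hsumS] at hsum
  have hbd : ∀ T : Finset (ZMod p), ∑ i ∈ T, (X i).card ≤ T.card * N := fun T => by
    simpa using Finset.sum_le_card_nsmul T (fun i => (X i).card) N (fun i _ => hle i)
  have hmS : m ≤ S.card := by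
    have := hsum.trans (hbd S)
    exact le_of_mul_le_mul_right this hNpos
  refine ⟨hmS, ?_⟩
  obtain ⟨B, hBS, hBm, hmax⟩ := exists_subset_card_eq_forall_le S (fun i => (X i).card) m hmS
  have hsplit : ∑ i ∈ S \ B, (X i).card + ∑ i ∈ B, (X i).card = ∑ i ∈ S, (X i).card :=
    Finset.sum_sdiff hBS
  have hcardSB : (S \ B).card = S.card - m := by rw [Finset.card_sdiff_of_subset hBS, hBm]
  have hSB : ∀ b ∈ B, ∑ i ∈ S \ B, (X i).card ≤ (S.card - m) * (X b).card := fun b hb => by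
    rw [← hcardSB]
    simpa using Finset.sum_le_card_nsmul (S \ B) (fun i => (X i).card) _
      (fun i hi => hmax i hi b hb)
  obtain ⟨c, hc⟩ := hodd
  refine ⟨B, hBS, hBm, ?_, ?_⟩
  · intro i hi j hj hij
    by_contra! hlt
    wlog hle' : (X i).card ≤ (X j).card generalizing i j
    · exact this j hj i hi hij.symm (by omega) (by omega)
    have h1 := hSB i hi
    have h2 : (S.card - m) * (X i).card ≤ 2 * (X i).card := Nat.mul_le_mul_right _ (by omega)
    have h3 := Finset.add_sum_erase B (fun i => (X i).card) hi
    have hj' : j ∈ B.erase i := Finset.mem_erase.2 ⟨hij.symm, hj⟩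
    have h4 := Finset.add_sum_erase (B.erase i) (fun i => (X i).card) hj'
    have h5 := hbd ((B.erase i).erase j)
    have h6 := Finset.card_erase_add_one hi
    have h7 := Finset.card_erase_add_one hj'
    have h8 : ((B.erase i).erase j).card = m - 2 := by omega
    rw [h8] at h5
    obtain ⟨r, rfl⟩ : ∃ r, m = r + 2 := ⟨m - 2, by omega⟩
    have h9 : r + 2 - 2 = r := by omega
    rw [h9] at h5
    have h10 : (r + 2) * N = r * N + 2 * N := by ring
    omega
  · intro hs1 i hi
    by_contra! hlt
    have h1 := hSB i hi
    have h2 : (S.card - m) * (X i).card ≤ 1 * (X i).card := Nat.mul_le_mul_right _ (by omega)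
    have h3 := Finset.add_sum_erase B (fun i => (X i).card) hi
    have h5 := hbd (B.erase i)
    have h6 := Finset.card_erase_add_one hi
    have h8 : (B.erase i).card = m - 1 := by omega
    rw [h8] at h5
    obtain ⟨r, rfl⟩ : ∃ r, m = r + 1 := ⟨m - 1, by omega⟩
    have h9 : r + 1 - 1 = r := by omega
    rw [h9] at h5
    have h10 : (r + 1) * N = r * N + N := by ring
    omega

lemma LayerFree.exists_window {m : ℕ} {τ : ℝ} (hp : p = 4 * m + 3) (hm : 3 ≤ m)
    (hodd : Odd (Fintype.card K)) (hX : LayerFree X)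
    (hsum : m * Fintype.card K ≤ ∑ i, (X i).card) (hs : (layerSupp X).card ≤ m + 2)
    (hfeas : Feasible (1 / 4 : ℝ) τ) (hτ : 5 ≤ τ * m) :
    ∃ (y d : ZMod p) (h : ℕ) (B : Finset (ZMod p)), d ≠ 0 ∧ h ≤ 3 ∧ B ⊆ layerSupp X ∧ B.card = m ∧
      (∀ i ∈ B, ∀ j ∈ B, i ≠ j → Fintype.card K < (X i).card + (X j).card) ∧
      (∀ x ∈ B, ∃ i : ℕ, i < m + h ∧ x = y + i * d) ∧
      (h = 1 ∨ ∀ x ∈ layerSupp X, ∃ i : ℕ, i < m + h ∧ x = y + i * d) := by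
  obtain ⟨hmS, B, hBS, hBm, hB1, hB2⟩ := LayerFree.exists_heavy (by omega) hodd hsum hs
  set S := layerSupp X with hS
  by_cases hap : (S - S).card ≤ 2 * S.card
  · obtain ⟨y, d, hd, hy⟩ := exists_progression_of_card_sub_le (by omega) S (by omega) hap (by omega)
    have h1 : m + (S.card - m) = S.card := by omega
    refine ⟨y, d, S.card - m, B, hd, by omega, hBS, hBm, hB1, ?_, Or.inr ?_⟩
    · rw [h1]; exact fun x hx => hy x (hBS hx)
    · rw [h1]; exact hy
  · push Not at hap
    have hdisj : ∀ i j, Fintype.card K < (X i).card + (X j).card → i + j ∉ S - S := by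
      intro i j hij h
      obtain ⟨u, hu, k, hk, h⟩ := Finset.mem_sub.1 h
      apply hX.not_mem_layerSupp hij hk
      rw [← h]
      simpa using hu
    have hcard : ∀ T : Finset (ZMod p), (∀ x ∈ T, x ∉ S - S) → T.card + (S - S).card ≤ p :=
      fun T hT => by
        rw [← Finset.card_union_of_disjoint (Finset.disjoint_left.2 hT)]
        have := Finset.card_le_univ (T ∪ (S - S))
        rwa [ZMod.card] at this
    have hBB : (B + B).card + (S - S).card ≤ p + (S.card - (m + 1)) := by
      rcases Nat.lt_or_ge (m + 1) S.card with hlt | hge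
      · by_cases hex : ∃ b ∈ B, ¬ Fintype.card K < (X b).card + (X b).card
        · obtain ⟨b, hb, hbN⟩ := hex
          have h1 := hcard ((B + B).erase (b + b)) (by
            intro x hx
            obtain ⟨i, hi, j, hj, rfl⟩ := Finset.mem_add.1 (Finset.mem_of_mem_erase hx)
            apply hdisj
            by_cases hij : i = j
            · subst hij
              have hib : i ≠ b := by rintro rfl; exact Finset.ne_of_mem_erase hx rfl
              have := hB1 i hi b hb hib
              omega
            · exact hB1 i hi j hj hij)
          have h2 := Finset.card_erase_add_one (Finset.add_mem_add hb hb)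
          omega
        · push Not at hex
          have h1 := hcard (B + B) (by
            intro x hx
            obtain ⟨i, hi, j, hj, rfl⟩ := Finset.mem_add.1 hx
            apply hdisj
            by_cases hij : i = j
            · subst hij; exact hex i hi
            · exact hB1 i hi j hj hij)
          omega
      · have h1 := hcard (B + B) (by
          intro x hx
          obtain ⟨i, hi, j, hj, rfl⟩ := Finset.mem_add.1 hx
          apply hdisj
          by_cases hij : i = j
          · subst hij; exact hB2 hge i hi
          · exact hB1 i hi j hj hij)
        omega
    have hBBset : ((B : Set (ZMod p)) + (B : Set (ZMod p))).ncard = (B + B).card := by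
      rw [← Finset.coe_add, Set.ncard_coe_finset]
    obtain ⟨y, d, hd, hy⟩ := hfeas p Fact.out (B : Set (ZMod p))
      (by rw [Set.ncard_coe_finset, hBm, hp]; push_cast; linarith)
      (by
        rw [hBBset, Set.ncard_coe_finset, hBm]
        have : (B + B).card ≤ 2 * m + 2 := by omega
        have : ((B + B).card : ℝ) ≤ 2 * m + 2 := by exact_mod_cast this
        nlinarith)
    rw [hBBset, Set.ncard_coe_finset, hBm] at hy
    rcases Nat.lt_or_ge m S.card with hlt | hge
    · refine ⟨y, d, 1, B, hd, by omega, hBS, hBm, hB1, ?_, Or.inl rfl⟩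
      intro x hx
      obtain ⟨i, hi, h⟩ := hy (Finset.mem_coe.2 hx)
      exact ⟨i, by omega, h⟩
    · have hwin : ∀ x ∈ B, ∃ i : ℕ, i < m + 3 ∧ x = y + i * d := by
        intro x hx
        obtain ⟨i, hi, h⟩ := hy (Finset.mem_coe.2 hx)
        exact ⟨i, by omega, h⟩
      have hBS' : B = S := Finset.eq_of_subset_of_card_le hBS (by omega)
      refine ⟨y, d, 3, B, hd, by omega, hBS, hBm, hB1, hwin, Or.inr ?_⟩
      rw [← hBS']; exact hwin

end

lemma ZMod.exists_int_rep {p : ℕ} [NeZero p] (c : ZMod p) (lo : ℤ) :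
    ∃ t : ℤ, lo ≤ t ∧ t < lo + p ∧ (t : ZMod p) = c := by
  refine ⟨lo + (c - (lo : ZMod p)).val, by omega, ?_, ?_⟩
  · have := ZMod.val_lt (c - (lo : ZMod p)); omega
  · push_cast
    rw [ZMod.natCast_zmod_val]
    ring

section DenseInInterval
variable {T : Finset ℤ} {L h : ℤ}

lemma card_Icc_le_of_dense (hT : T ⊆ Finset.Icc 0 (L - 1)) (hc : L ≤ T.card + h) {lo hi : ℤ}
    (hlo : 0 ≤ lo) (hhi : hi ≤ L - 1) (hle : lo ≤ hi + 1) :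
    hi + 1 - lo ≤ (T ∩ Finset.Icc lo hi).card + h := by
  have h1 : T \ Finset.Icc lo hi ⊆ Finset.Icc 0 (L - 1) \ Finset.Icc lo hi :=
    Finset.sdiff_subset_sdiff hT le_rfl
  have h2 := Finset.card_le_card h1
  have h3 : Finset.Icc lo hi ⊆ Finset.Icc 0 (L - 1) := Finset.Icc_subset_Icc hlo hhi
  rw [Finset.card_sdiff_of_subset h3] at h2
  have h4 := Finset.card_sdiff_add_card_inter T (Finset.Icc lo hi)
  rw [Int.card_Icc, Int.card_Icc] at h2
  omega

lemma exists_mem_Icc_of_dense (hT : T ⊆ Finset.Icc 0 (L - 1)) (hc : L ≤ T.card + h) {lo hi : ℤ}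
    (hlo : 0 ≤ lo) (hhi : hi ≤ L - 1) (hh : 0 ≤ h) (hle : lo + h ≤ hi) :
    ∃ t ∈ T, lo ≤ t ∧ t ≤ hi := by
  have h1 := card_Icc_le_of_dense hT hc hlo hhi (by omega)
  obtain ⟨t, ht⟩ := Finset.card_pos.1 (show 0 < (T ∩ Finset.Icc lo hi).card by omega)
  rw [Finset.mem_inter, Finset.mem_Icc] at ht
  exact ⟨t, ht.1, ht.2⟩

lemma exists_add_eq_of_dense (hT : T ⊆ Finset.Icc 0 (L - 1)) (hc : L ≤ T.card + h) (hh : 0 ≤ h)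
    {r : ℤ} (hr1 : 2 * h + 1 ≤ r) (hr2 : r ≤ 2 * L - 3 - 2 * h) :
    ∃ i ∈ T, ∃ j ∈ T, i ≠ j ∧ i + j = r := by
  have key : ∀ lo hi, lo + hi = r → 0 ≤ lo → hi ≤ L - 1 → 2 * h + 1 ≤ hi - lo → 
      ∃ i ∈ T, ∃ j ∈ T, i ≠ j ∧ i + j = r := by
    intro lo hi hlh hlo hhi hle
    have h1 := card_Icc_le_of_dense hT hc hlo hhi (by omega)
    set U := T ∩ Finset.Icc lo hi with hU
    have h2 : (U.image (fun i => r - i)).card = U.card :=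
      Finset.card_image_of_injective _ sub_right_injective
    have h3 : U ∪ U.image (fun i => r - i) ⊆ Finset.Icc lo hi := by
      refine Finset.union_subset Finset.inter_subset_right ?_
      intro x hx
      obtain ⟨i, hi, rfl⟩ := Finset.mem_image.1 hx
      rw [hU, Finset.mem_inter, Finset.mem_Icc] at hi
      rw [Finset.mem_Icc]
      omega
    have h4 := Finset.card_le_card h3
    rw [Int.card_Icc] at h4
    have h5 := Finset.card_union_add_card_inter U (U.image (fun i => r - i))
    obtain ⟨i, hi, j, hj, hij⟩ := Finset.one_lt_card.1
      (show 1 < (U ∩ U.image (fun i => r - i)).card by omega)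
    have hmem : ∀ i ∈ U ∩ U.image (fun i => r - i), i ∈ T ∧ r - i ∈ T := by
      intro i hi
      obtain ⟨hi1, hi2⟩ := Finset.mem_inter.1 hi
      obtain ⟨j, hj, hji⟩ := Finset.mem_image.1 hi2
      refine ⟨(Finset.mem_inter.1 hi1).1, ?_⟩
      rw [← hji, sub_sub_cancel]
      exact (Finset.mem_inter.1 hj).1
    by_cases h6 : i = r - i
    · exact ⟨j, (hmem j hj).1, r - j, (hmem j hj).2, by omega, by ring⟩
    · exact ⟨i, (hmem i hi).1, r - i, (hmem i hi).2, h6, by ring⟩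
  rcases le_or_gt r (L - 1) with h1 | h1
  · exact key 0 r (by ring) le_rfl h1 (by omega)
  · exact key (r - (L - 1)) (L - 1) (by ring) (by omega) le_rfl (by omega)

lemma exists_sub_eq_of_dense (hT : T ⊆ Finset.Icc 0 (L - 1)) (hc : L ≤ T.card + h) (hh : 0 ≤ h)
    {r : ℤ} (hr1 : -(L - 2 * h - 1) ≤ r) (hr2 : r ≤ L - 2 * h - 1) :
    ∃ i ∈ T, ∃ j ∈ T, i - j = r := by
  wlog hr : 0 ≤ r generalizing r
  · obtain ⟨i, hi, j, hj, h⟩ := this (r := -r) (by omega) (by omega) (by omega)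
    exact ⟨j, hj, i, hi, by omega⟩
  have h1 := card_Icc_le_of_dense hT hc (lo := 0) (hi := L - 1 - r) le_rfl (by omega) (by omega)
  have h1' := card_Icc_le_of_dense hT hc (lo := r) (hi := L - 1) hr (by omega) (by omega)
  set U := T ∩ Finset.Icc 0 (L - 1 - r) with hU
  have h2 : (U.image (fun i => r + i)).card = U.card :=
    Finset.card_image_of_injective _ (add_right_injective r)
  have h3 : U.image (fun i => r + i) ⊆ Finset.Icc r (L - 1) := by
    intro x hx
    obtain ⟨i, hi, rfl⟩ := Finset.mem_image.1 hx
    rw [hU, Finset.mem_inter, Finset.mem_Icc] at hi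
    rw [Finset.mem_Icc]
    omega
  obtain ⟨i, hi⟩ := Finset.inter_nonempty_of_card_lt_card_add_card h3
    (Finset.inter_subset_right (s₁ := T)) (by rw [Int.card_Icc]; omega)
  rw [Finset.mem_inter, Finset.mem_inter] at hi
  obtain ⟨j, hj, hji⟩ := Finset.mem_image.1 hi.1
  exact ⟨i, hi.2.1, j, (Finset.mem_inter.1 hj).1, by omega⟩

end DenseInInterval

section
variable {p : ℕ} [Fact p.Prime] {K : Type*} [AddCommGroup K] [Fintype K] [DecidableEq K]
  {X : ZMod p → Finset K}

/-- A window containing the heavy layers determines its own position. -/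
lemma LayerFree.window_position {m h : ℕ} (hp : p = 4 * m + 3) (hm : 23 ≤ m) (hh : h ≤ 3)
    (hX : LayerFree X) (y : ZMod p) (B : Finset (ZMod p)) (hBS : B ⊆ layerSupp X)
    (hBm : B.card = m)
    (hB : ∀ i ∈ B, ∀ j ∈ B, i ≠ j → Fintype.card K < (X i).card + (X j).card)
    (hwin : ∀ x ∈ B, ∃ i : ℕ, i < m + h ∧ x = y + i)
    (hS : h = 1 ∨ ∀ x ∈ layerSupp X, ∃ i : ℕ, i < m + h ∧ x = y + i) :
    ∃ z g : ℤ, 2 * y = z ∧ m - 3 * h - 1 ≤ z ∧ z ≤ m + h + 6 ∧ (g = 0 ∨ g = 4 ∧ h = 1) ∧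
      ∀ x ∈ layerSupp X, ∃ i : ℤ, -g ≤ i ∧ i ≤ m + h - 1 + g ∧ x = y + i := by
  set T : Finset ℤ := (Finset.Icc 0 ((m + h : ℤ) - 1)).filter (fun i => y + i ∈ B) with hTdef
  have hT : T ⊆ Finset.Icc 0 ((m + h : ℤ) - 1) := Finset.filter_subset _ _
  have hTB : ∀ i ∈ T, y + i ∈ B := fun i hi => (Finset.mem_filter.1 hi).2
  have hc : (m + h : ℤ) ≤ T.card + h := by
    have h1 : B ⊆ T.image (fun i : ℤ => y + i) := by
      intro x hx
      obtain ⟨i, hi, rfl⟩ := hwin x hx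
      refine Finset.mem_image.2 ⟨i, Finset.mem_filter.2 ⟨?_, by simpa using hx⟩, by simp⟩
      rw [Finset.mem_Icc]; omega
    have h2 := (Finset.card_le_card h1).trans Finset.card_image_le
    omega
  have hinj : ∀ i j : ℤ, i ∈ T → j ∈ T → i ≠ j → y + i ≠ y + j := by
    intro i j hi hj hij h
    have h1 := add_left_cancel h
    rw [ZMod.intCast_eq_intCast_iff_dvd_sub] at h1
    obtain ⟨c, hc⟩ := h1
    have h2 := Finset.mem_Icc.1 (hT hi)
    have h3 := Finset.mem_Icc.1 (hT hj)
    have : c < 1 := by nlinarith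
    have : -1 < c := by nlinarith
    have : c = 0 := by omega
    subst this
    omega
  have hcore : ∀ r : ℤ, 2 * h + 1 ≤ r → r ≤ 2 * (m + h) - 3 - 2 * h → ∀ k ∈ layerSupp X,
      2 * y + r + k ∉ layerSupp X := by
    intro r hr1 hr2 k hk
    obtain ⟨i, hi, j, hj, hij, rfl⟩ := exists_add_eq_of_dense hT hc (by omega) hr1 hr2
    have := hX.not_mem_layerSupp (hB _ (hTB i hi) _ (hTB j hj) (hinj i j hi hj hij)) hk
    convert this using 2
    push_cast
    ring
  obtain ⟨z, hz0, hzp, hz⟩ := ZMod.exists_int_rep (2 * y) ((m : ℤ) - 3 * h - 1)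
  have hz1 : z ≤ m + h + 6 := by
    by_contra! hlt
    obtain ⟨d, r, hd1, hd2, hr1, hr2, hdr⟩ : ∃ d r : ℤ, -((m + h) - 2 * h - 1) ≤ d ∧
        d ≤ (m + h) - 2 * h - 1 ∧ 2 * h + 1 ≤ r ∧ r ≤ 2 * (m + h) - 3 - 2 * h ∧ z + r = d + p := by
      rcases le_or_gt z ((p : ℤ) - m - h + 2) with h1 | h1
      · exact ⟨z + (2 * (m + h) - 3 - 2 * h) - p, 2 * (m + h) - 3 - 2 * h, by omega, by omega,
          by omega, by omega, by ring⟩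
      · exact ⟨z + (2 * h + 1) - p, 2 * h + 1, by omega, by omega, by omega, by omega, by ring⟩
    obtain ⟨i, hi, j, hj, hij⟩ := exists_sub_eq_of_dense hT hc (by omega) hd1 hd2
    apply hcore r hr1 hr2 _ (hBS (hTB j hj))
    have h1 : 2 * y + r + (y + j) = y + i := by
      rw [← hz]
      have h2 : ((z + r : ℤ) : ZMod p) = ((d + p : ℤ) : ZMod p) := by rw [hdr]
      rw [← hij] at h2
      push_cast at h2
      rw [CharP.cast_eq_zero] at h2
      linear_combination h2
    rw [h1]
    exact hBS (hTB i hi)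
  rcases hS with hS | hS
  · subst hS
    refine ⟨z, 4, hz.symm, by exact_mod_cast hz0, by exact_mod_cast hz1, Or.inr ⟨rfl, rfl⟩, ?_⟩
    intro x hx
    obtain ⟨i, hi0, hip, hi⟩ := ZMod.exists_int_rep (x - y) (-4)
    refine ⟨i, hi0, ?_, by rw [hi]; ring⟩
    by_contra! hlt
    have hA : ¬ (z + 4 ≤ i ∧ i ≤ z + 3 * m - 4) := by
      rintro ⟨h1, h2⟩
      obtain ⟨j, hj, hj1, hj2⟩ := exists_mem_Icc_of_dense hT hc
        (lo := max 0 (i - z - (2 * m - 3))) (hi := min m (i - z - 3)) (by omega)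
        (by push_cast; omega) (by omega) (by push_cast; omega)
      apply hcore (i - z - j) (by push_cast; omega) (by push_cast; omega) _ (hBS (hTB j hj))
      have h1 : 2 * y + ((i - z - j : ℤ) : ZMod p) + (y + j) = x := by
        push_cast
        rw [hz, hi]; ring
      rwa [h1]
    have hB' : ¬ (2 * m + 7 - z ≤ i ∧ i ≤ 5 * m - 1 - z) := by
      rintro ⟨h1, h2⟩
      obtain ⟨j, hj, hj1, hj2⟩ := exists_mem_Icc_of_dense hT hc
        (lo := max 0 (i + z + 3 - p)) (hi := min m (i + z + (2 * m - 3) - p)) (by omega)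
        (by push_cast; omega) (by omega) (by push_cast; omega)
      apply hcore (j - i - z + p) (by push_cast; omega) (by push_cast; omega) _ hx
      have h1 : 2 * y + ((j - i - z + p : ℤ) : ZMod p) + x = y + j := by
        push_cast
        rw [hz, hi, CharP.cast_eq_zero]; ring
      rw [h1]
      exact hBS (hTB j hj)
    push_cast at hz0 hz1 hlt
    omega
  · refine ⟨z, 0, hz.symm, hz0, hz1, Or.inl rfl, ?_⟩
    intro x hx
    obtain ⟨i, hi, rfl⟩ := hS x hx
    exact ⟨i, by omega, by omega, by simp⟩

end

lemma ZMod.two_ne_zero' {p : ℕ} [Fact p.Prime] (hp2 : p ≠ 2) : (2 : ZMod p) ≠ 0 := by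
  intro h
  have h3 : ((2 : ℕ) : ZMod p) = 0 := by exact_mod_cast h
  rw [ZMod.natCast_eq_zero_iff] at h3
  exact hp2 ((Nat.prime_dvd_prime_iff_eq Fact.out Nat.prime_two).1 h3)

section
variable {p : ℕ} [Fact p.Prime] {K : Type*} [AddCommGroup K] [Fintype K] [DecidableEq K]
  {X : ZMod p → Finset K}

omit [Fintype K] [DecidableEq K] in
lemma LayerFree.scale (hX : LayerFree X) (c : ZMod p) : LayerFree (fun i => X (c * i)) := by
  intro i j k x hx y hy z hz h
  apply hX _ _ _ x hx y hy z hz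
  simpa only [mul_add] using h

/-- The element at which the extremal interval starts. -/
def extremalStart (p m : ℕ) : ZMod p := ((m + 2 : ℕ) : ZMod p) * (2 : ZMod p)⁻¹

lemma two_mul_extremalStart {m : ℕ} (hp2 : p ≠ 2) :
    2 * extremalStart p m = (m : ZMod p) + 2 := by
  unfold extremalStart
  push_cast
  field_simp [ZMod.two_ne_zero' hp2]

/-- After rescaling, the support lies in a short interval around the extremal one. -/
lemma LayerFree.exists_normalized {m : ℕ} {τ : ℝ} (hp : p = 4 * m + 3) (hm : 23 ≤ m)
    (hodd : Odd (Fintype.card K)) (hX : LayerFree X)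
    (hsum : m * Fintype.card K ≤ ∑ i, (X i).card)
    (hbig : ∃ i, m * Fintype.card K ≤ (m + 1) * (X i).card)
    (hfeas : Feasible (1 / 4 : ℝ) τ) (hτ : 5 ≤ τ * m) :
    ∃ c : ZMod p, c ≠ 0 ∧ ∃ α β : ℤ, -7 ≤ α ∧ β ≤ m + 6 ∧ β - α ≤ m + 8 ∧
      ∀ x ∈ layerSupp (fun i => X (c * i)), ∃ t : ℤ, α ≤ t ∧ t ≤ β ∧ x = extremalStart p m + (t : ZMod p) := by
  obtain ⟨y, d, h, B, hd, hh, hBS, hBm, hB, hwin, hS⟩ :=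
    hX.exists_window hp (by omega) hodd hsum (hX.card_layerSupp_le hp (by omega) hsum hbig) hfeas hτ
  have hmem : ∀ x, x ∈ layerSupp (fun i => X (d * i)) ↔ d * x ∈ layerSupp X := fun x => by
    rw [mem_layerSupp, mem_layerSupp]
  have hmemB : ∀ x, x ∈ B.image (fun b => d⁻¹ * b) ↔ d * x ∈ B := fun x => by
    rw [Finset.mem_image]
    constructor
    · rintro ⟨b, hb, rfl⟩; rwa [mul_inv_cancel_left₀ hd]
    · intro hx; exact ⟨_, hx, inv_mul_cancel_left₀ hd x⟩
  have hdiv : ∀ (x : ZMod p) (i : ℕ), d * x = y + i * d → x = d⁻¹ * y + i := fun x i hx => by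
    apply mul_left_cancel₀ hd
    rw [hx, mul_add, mul_inv_cancel_left₀ hd, mul_comm d]
  obtain ⟨z, g, hz, hz0, hz1, hg, hsupp⟩ := (hX.scale d).window_position hp hm hh (d⁻¹ * y)
    (B.image (fun b => d⁻¹ * b)) (fun x hx => (hmem x).2 (hBS ((hmemB x).1 hx)))
    (by rw [Finset.card_image_of_injective _ (mul_right_injective₀ (inv_ne_zero hd)), hBm])
    (fun i hi j hj hij => hB _ ((hmemB i).1 hi) _ ((hmemB j).1 hj)
      (fun h => hij (mul_left_cancel₀ hd h)))
    (fun x hx => by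
      obtain ⟨i, hi, h⟩ := hwin _ ((hmemB x).1 hx)
      exact ⟨i, hi, hdiv x i h⟩)
    (hS.imp_right fun hS x hx => by
      obtain ⟨i, hi, h⟩ := hS _ ((hmem x).1 hx)
      exact ⟨i, hi, hdiv x i h⟩)
  have h2 : (2 : ZMod p) ≠ 0 := ZMod.two_ne_zero' (by omega)
  have ha0 := two_mul_extremalStart (p := p) (m := m) (by omega)
  have hp0 : ((4 * m + 3 : ℕ) : ZMod p) = 0 := by rw [← hp]; exact CharP.cast_eq_zero _ _
  push_cast at hp0
  rcases Int.even_or_odd (z - m) with ⟨u, hu⟩ | ⟨u, hu⟩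
  · have hy : d⁻¹ * y = extremalStart p m + ((u - 1 : ℤ) : ZMod p) := by
      apply mul_left_cancel₀ h2
      rw [hz, mul_add, ha0, show z = m + 2 * u by omega]
      push_cast
      ring
    refine ⟨d, hd, u - 1 - g, u - 1 + (m + h - 1) + g, by omega, by omega, by omega, ?_⟩
    intro x hx
    obtain ⟨i, hi0, hi1, rfl⟩ := hsupp x hx
    refine ⟨u - 1 + i, by omega, by omega, ?_⟩
    rw [hy]
    push_cast
    ring
  · obtain ⟨v, hv⟩ : ∃ v : ℤ, v = 1 - u - h := ⟨_, rfl⟩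
    have hy : d⁻¹ * y = -extremalStart p m - ((v + m + h - 1 : ℤ) : ZMod p) := by
      apply mul_left_cancel₀ h2
      rw [hz, mul_sub, mul_neg, ha0, show z = m + 2 * u + 1 by omega, hv]
      push_cast
      linear_combination hp0
    refine ⟨-d, neg_ne_zero.2 hd, v - g, v + (m + h - 1) + g, by omega, by omega, by omega, ?_⟩
    intro x hx
    have hx' : -x ∈ layerSupp (fun i => X (d * i)) := by
      rw [hmem]
      rw [mem_layerSupp] at hx ⊢
      simpa using hx
    obtain ⟨i, hi0, hi1, hxi⟩ := hsupp _ hx'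
    refine ⟨v + m + h - 1 - i, by omega, by omega, ?_⟩
    rw [← neg_neg x, hxi, hy]
    push_cast
    ring

end

lemma sum_Icc_eq_left_add {a b : ℤ} (h : a ≤ b) (w : ℤ → ℕ) :
    ∑ t ∈ Finset.Icc a b, w t = w a + ∑ t ∈ Finset.Icc (a + 1) b, w t := by
  have : Finset.Icc a b = insert a (Finset.Icc (a + 1) b) := by
    ext; simp only [Finset.mem_Icc, Finset.mem_insert]; omega
  rw [this, Finset.sum_insert (by simp)]

lemma sum_Icc_eq_right_add {a b : ℤ} (h : a ≤ b) (w : ℤ → ℕ) :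
    ∑ t ∈ Finset.Icc a b, w t = w b + ∑ t ∈ Finset.Icc a (b - 1), w t := by
  have : Finset.Icc a b = insert b (Finset.Icc a (b - 1)) := by
    ext; simp only [Finset.mem_Icc, Finset.mem_insert]; omega
  rw [this, Finset.sum_insert (by simp)]

lemma sum_Icc_le_mul {w : ℤ → ℕ} {N : ℕ} (hw : ∀ t, w t ≤ N) {a b : ℤ} {c : ℕ} (hc : b + 1 - a ≤ c) :
    ∑ t ∈ Finset.Icc a b, w t ≤ c * N := by
  have := Finset.sum_le_card_nsmul (Finset.Icc a b) w N (fun t _ => hw t)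
  rw [Int.card_Icc, smul_eq_mul] at this
  exact this.trans (Nat.mul_le_mul_right _ (by omega))

lemma eq_of_mul_le_sum_Icc {w : ℤ → ℕ} {N : ℕ} (hw : ∀ t, w t ≤ N) {a b : ℤ} {c : ℕ}
    (hc : b + 1 - a ≤ c) (h : c * N ≤ ∑ t ∈ Finset.Icc a b, w t) {t : ℤ} (hat : a ≤ t) (htb : t ≤ b) :
    w t = N := by
  refine le_antisymm (hw t) ?_
  by_contra! hlt
  have h1 := Finset.sum_lt_sum (s := Finset.Icc a b) (f := w) (g := fun _ => N) (fun i _ => hw i)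
    ⟨t, Finset.mem_Icc.2 ⟨hat, htb⟩, hlt⟩
  rw [Finset.sum_const, Int.card_Icc, smul_eq_mul] at h1
  have := h.trans_lt h1
  have h2 : (b + 1 - a).toNat ≤ c := by omega
  exact absurd (Nat.mul_le_mul_right N h2) (by omega)

lemma two_mul_sum_Icc_le {w : ℤ → ℕ} {N : ℕ} {a q : ℤ} {L : ℕ} (hL : (L : ℤ) = q - a + 1 - a ∨ L = 0 ∧ q - a < a)
    (h : ∀ t t', t + t' = q → w t + w t' ≤ N) :
    2 * ∑ t ∈ Finset.Icc a (q - a), w t ≤ L * N := by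
  have := two_mul_sum_le_of_involution (Finset.Icc a (q - a)) (fun t => q - t) w N
    (fun x hx => by simp only [Finset.mem_Icc] at hx ⊢; omega) (fun x _ => by ring)
    (fun x _ => h _ _ (by ring))
  rw [Int.card_Icc] at this
  rwa [show L = (q - a + 1 - a).toNat by omega]

/-- A set of size `|G| - |Z|` all of whose triple sums avoid `Z` is a coset. -/
lemma exists_coset_of_triple_sum_disjoint {G : Type*} [AddCommGroup G] [Fintype G] [DecidableEq G]
    (X Z : Finset G) (hX : X.Nonempty) (h : ∀ a ∈ X, ∀ b ∈ X, ∀ c ∈ X, a + b + c ∉ Z)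
    (hcard : Fintype.card G ≤ X.card + Z.card) :
    ∃ (x : G) (H : AddSubgroup G), (∀ y, y ∈ X ↔ y - x ∈ H) ∧ ∀ y, y ∈ Z ↔ y - (x + x + x) ∉ H := by
  have hsub : X + X + X ⊆ Zᶜ := by
    intro y hy
    obtain ⟨u, hu, c, hc, rfl⟩ := Finset.mem_add.1 hy
    obtain ⟨a, ha, b, hb, rfl⟩ := Finset.mem_add.1 hu
    exact Finset.mem_compl.2 (h a ha b hb c hc)
  have h3 : (X + X + X).card ≤ X.card := by
    have := Finset.card_le_card hsub
    rw [Finset.card_compl] at this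
    omega
  have h2 : (X + X).card ≤ X.card := (Finset.card_le_card_add_right hX).trans h3
  obtain ⟨x, hx⟩ := hX
  have hst := Finset.vadd_stabilizer_of_no_doubling h2 hx
  have hmem : ∀ y, y ∈ X ↔ y - x ∈ AddAction.stabilizer G X := by
    intro y
    rw [← Finset.mem_coe, ← hst, Set.mem_vadd_set_iff_neg_vadd_mem, vadd_eq_add, neg_add_eq_sub,
      SetLike.mem_coe]
  have heq : X + X + X = Zᶜ := by
    apply Finset.eq_of_subset_of_card_le hsub
    rw [Finset.card_compl]
    have h4 : X.card ≤ (X + X + X).card := Finset.card_le_card_add_left ⟨x + x, Finset.add_mem_add hx hx⟩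
    omega
  refine ⟨x, AddAction.stabilizer G X, hmem, fun y => ?_⟩
  rw [← not_iff_not, not_not, ← Finset.mem_compl, ← heq]
  constructor
  · intro hy
    obtain ⟨u, hu, c, hc, rfl⟩ := Finset.mem_add.1 hy
    obtain ⟨a, ha, b, hb, rfl⟩ := Finset.mem_add.1 hu
    rw [hmem] at ha hb hc
    convert add_mem (add_mem ha hb) hc using 1
    abel
  · intro hy
    refine Finset.mem_add.2 ⟨x + x, Finset.add_mem_add hx hx, y - (x + x), ?_, by abel⟩
    rw [hmem]
    convert hy using 1
    abel

section
variable {K : Type*} [AddCommGroup K] [Fintype K] [DecidableEq K]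

/-- Layers around the extremal interval, indexed by integers, of a `(3,1)`-sum-free set. -/
def IntLayerFree (m : ℕ) (Y : ℤ → Finset K) : Prop :=
  ∀ t₁ t₂ t₃ t₄ : ℤ, (t₄ = t₁ + t₂ + t₃ + m + 2 ∨ t₄ = t₁ + t₂ + t₃ - 3 * m - 1) →
    ∀ x ∈ Y t₁, ∀ y ∈ Y t₂, ∀ z ∈ Y t₃, x + y + z ∉ Y t₄

variable {m : ℕ} {Y : ℤ → Finset K}

lemma IntLayerFree.window_cases (hY : IntLayerFree m Y) (hm : 23 ≤ m) {α β : ℤ} (hα : -7 ≤ α)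
    (hβ : β ≤ m + 6) (hD : β - α ≤ m + 8) (hYα : (Y α).Nonempty) (hYβ : (Y β).Nonempty)
    (hαβ : α ≤ β)
    (hsum : m * Fintype.card K ≤ ∑ t ∈ Finset.Icc α β, (Y t).card) :
    (0 ≤ α ∧ β ≤ m) ∨ (α = -1 ∧ β = m - 2) ∨ (α = 1 ∧ β = m + 1) ∨ (α = -1 ∧ β = m - 1) ∨
      (α = -2 ∧ β = m - 1) ∨ (α = 0 ∧ β = m + 1) ∨ (α = -1 ∧ β = m) := by
  set N := Fintype.card K with hN
  set w : ℤ → ℕ := fun t => (Y t).card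
  have hw : ∀ t, w t ≤ N := fun t => Finset.card_le_univ _
  have hNpos : 0 < N := Fintype.card_pos
  set q : ℤ := β - α - m - 2 with hq
  set q' : ℤ := 3 * m + 1 - (β - α) with hq'
  have hpair1 : ∀ t t', t + t' = q → w t + w t' ≤ N := fun t t' h =>
    card_add_card_le_of_disjoint _ _ _ _ hYα hYβ (hY t t' α β (by omega))
  have hpair2 : ∀ t t', t + t' = q' → w t + w t' ≤ N := fun t t' h =>
    card_add_card_le_of_disjoint _ _ _ _ hYβ hYα (hY t t' β α (by omega))
  obtain ⟨L1, hL1⟩ : ∃ L1 : ℕ, ((L1 : ℤ) = q - α + 1 - α ∨ L1 = 0 ∧ q - α < α) :=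
    ⟨(q - α + 1 - α).toNat, by omega⟩
  obtain ⟨L2, hL2⟩ : ∃ L2 : ℕ, ((L2 : ℤ) = q' - (q' - β) + 1 - (q' - β) ∨ L2 = 0 ∧ q' - (q' - β) < q' - β) :=
    ⟨(q' - (q' - β) + 1 - (q' - β)).toNat, by omega⟩
  have h1 := two_mul_sum_Icc_le hL1 hpair1
  have h2 := two_mul_sum_Icc_le hL2 hpair2
  rw [sub_sub_cancel] at h2
  set E := Finset.Icc α β \ (Finset.Icc α (q - α) ∪ Finset.Icc (q' - β) β) with hE
  have hsub : Finset.Icc α (q - α) ∪ Finset.Icc (q' - β) β ⊆ Finset.Icc α β := by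
    intro t
    simp only [Finset.mem_union, Finset.mem_Icc]
    omega
  have hdis : Disjoint (Finset.Icc α (q - α)) (Finset.Icc (q' - β) β) := by
    rw [Finset.disjoint_left]
    intro t
    simp only [Finset.mem_Icc]
    omega
  have h3 := Finset.sum_sdiff (f := w) hsub
  rw [Finset.sum_union hdis] at h3
  have h4 : ∑ t ∈ E, w t ≤ E.card * N := by
    simpa using Finset.sum_le_card_nsmul E w N (fun t _ => hw t)
  have hEc : E.card + L1 + L2 = (β + 1 - α).toNat := by
    have h5 := Finset.card_sdiff_add_card_eq_card hsub
    rw [Finset.card_union_of_disjoint hdis, Int.card_Icc, Int.card_Icc, Int.card_Icc] at h5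
    rw [hE]
    omega
  have h6 : 2 * m * N ≤ (2 * E.card + L1 + L2) * N := by
    have : m * N ≤ ∑ t ∈ E, w t + (∑ t ∈ Finset.Icc α (q - α), w t + ∑ t ∈ Finset.Icc (q' - β) β, w t) := by
      rw [h3]; exact hsum
    nlinarith
  have h7 := Nat.le_of_mul_le_mul_right h6 hNpos
  have h8 : (2 * m : ℤ) + L1 + L2 ≤ 2 * (β + 1 - α) := by omega
  clear h1 h2 h3 h4 h6 h7 hEc hdis hsub hE E hpair1 hpair2 hsum
  clear_value q q'
  have h9 : (L1 : ℤ) ≥ q - α + 1 - α := by omega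
  have h10 : (L2 : ℤ) ≥ 2 * β - q' + 1 := by omega
  clear hL1 hL2
  have h11 : β ≤ α + m + 1 := by omega
  have h12 : α + m - 1 ≤ β := by omega
  obtain h | h | h : β = α + m - 1 ∨ β = α + m ∨ β = α + m + 1 := by omega
  all_goals subst h; omega

/-- The possible shapes of a dense family of layers around the extremal interval. -/
lemma IntLayerFree.classification (hY : IntLayerFree m Y) (hm : 23 ≤ m) {α β : ℤ} (hα : -7 ≤ α)
    (hβ : β ≤ m + 6) (hD : β - α ≤ m + 8) (hYα : (Y α).Nonempty) (hYβ : (Y β).Nonempty)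
    (hαβ : α ≤ β)
    (hsum : m * Fintype.card K ≤ ∑ t ∈ Finset.Icc α β, (Y t).card) :
    (0 ≤ α ∧ β ≤ m) ∨ (∑ t ∈ Finset.Icc α β, (Y t).card ≤ m * Fintype.card K ∧
    ((α = -1 ∧ β = m - 2 ∧ ∀ t : ℤ, -1 ≤ t → t ≤ m - 2 → Y t = Finset.univ) ∨
    (α = -1 ∧ β = m - 1 ∧ (∀ t : ℤ, 0 ≤ t → t ≤ m - 2 → Y t = Finset.univ) ∧
      ∃ (x : K) (H : AddSubgroup K), H ≠ ⊤ ∧ (∀ y, y ∈ Y (-1) ↔ y - x ∈ H) ∧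
        ∀ y, y ∈ Y (m - 1) ↔ y - (x + x + x) ∉ H) ∨
    (α = -1 ∧ β = m ∧ (∀ t : ℤ, 1 ≤ t → t ≤ m - 2 → Y t = Finset.univ) ∧
      ∃ (x : K) (H : AddSubgroup K), (∀ y, y ∈ Y (-1) ↔ y - x ∈ H) ∧
        (∀ y, y ∈ Y (m - 1) ↔ y - (x + x + x) ∉ H) ∧
        (∀ y, y ∈ Y 0 ↔ y + (x + x) ∉ Y m) ∧ (∀ y ∈ Y m, ∀ h ∈ H, y + h ∈ Y m) ∧
        ∀ y ∈ Y m, ∀ z ∈ Y m, ∀ u ∈ Y m, y + z + u ≠ x))) := by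
  set N := Fintype.card K with hN
  set w : ℤ → ℕ := fun t => (Y t).card with hwdef
  have hw : ∀ t, w t ≤ N := fun t => Finset.card_le_univ _
  have hNpos : 0 < N := Fintype.card_pos
  have huniv : ∀ t, w t = N → Y t = Finset.univ := fun t h => Finset.eq_univ_of_card _ h
  have hlast : ∀ t₁ t₂ t₃ t₄ : ℤ, (t₄ = t₁ + t₂ + t₃ + m + 2 ∨ t₄ = t₁ + t₂ + t₃ - 3 * m - 1) →
      (Y t₂).Nonempty → (Y t₃).Nonempty → w t₁ + w t₄ ≤ N := fun t₁ t₂ t₃ t₄ h h2 h3 =>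
    card_add_card_le_of_disjoint' _ _ _ _ h2 h3 (hY t₁ t₂ t₃ t₄ h)
  have hfirst : ∀ t₁ t₂ t₃ t₄ : ℤ, (t₄ = t₁ + t₂ + t₃ + m + 2 ∨ t₄ = t₁ + t₂ + t₃ - 3 * m - 1) →
      (Y t₃).Nonempty → (Y t₄).Nonempty → w t₁ + w t₂ ≤ N := fun t₁ t₂ t₃ t₄ h h3 h4 =>
    card_add_card_le_of_disjoint _ _ _ _ h3 h4 (hY t₁ t₂ t₃ t₄ h)
  have hwα : 0 < w α := Finset.card_pos.2 hYα
  have hwβ : 0 < w β := Finset.card_pos.2 hYβ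
  obtain ⟨r, rfl⟩ : ∃ r, m = r + 6 := ⟨m - 6, by omega⟩
  have hmN : (r + 6) * N = r * N + 6 * N := by ring
  rcases hY.window_cases hm hα hβ hD hYα hYβ hαβ hsum with
    h | ⟨rfl, rfl⟩ | ⟨rfl, rfl⟩ | ⟨rfl, rfl⟩ | ⟨rfl, rfl⟩ | ⟨rfl, rfl⟩ | ⟨rfl, rfl⟩
  · exact Or.inl h
  · refine Or.inr ⟨sum_Icc_le_mul hw (by omega), Or.inl ⟨rfl, rfl, fun t h1 h2 => huniv t ?_⟩⟩
    exact eq_of_mul_le_sum_Icc hw (by omega) hsum h1 h2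
  · exfalso
    have h1 := hfirst (((r + 6 : ℕ) : ℤ) + 1) (r + 6 : ℕ) (((r + 6 : ℕ) : ℤ) + 1) 1 (by omega) hYβ hYα
    rw [sum_Icc_eq_right_add hαβ, sum_Icc_eq_right_add (by omega)] at hsum
    have h2 := eq_of_mul_le_sum_Icc hw (a := 1) (b := ((r + 6 : ℕ) : ℤ) + 1 - 1 - 1) (c := r + 5) (by omega)
      (by
        have : (r + 5) * N = r * N + 5 * N := by ring
        simp only [hwdef] at *
        rw [add_sub_cancel_right] at *
        omega) (t := 2) (by omega) (by omega)
    have h3 := hlast (((r + 6 : ℕ) : ℤ) + 1) _ _ 2 (by omega) hYβ hYβ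
    omega
  · right
    have h1 := hlast (-1) (-1) (-1) (((r + 6 : ℕ) : ℤ) - 1) (by omega) hYα hYα
    rw [sum_Icc_eq_right_add hαβ, sum_Icc_eq_left_add (by omega)] at hsum
    have e1 : (r + 5) * N = r * N + 5 * N := by ring
    have hle := sum_Icc_le_mul hw (a := -1 + 1) (b := ((r + 6 : ℕ) : ℤ) - 1 - 1) (c := r + 5) (by omega)
    refine ⟨?_, Or.inr (Or.inl ⟨rfl, rfl, fun t h2 h3 => huniv t ?_, ?_⟩)⟩
    · rw [sum_Icc_eq_right_add hαβ, sum_Icc_eq_left_add (by omega)]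
      simp only [hwdef] at *
      omega
    · refine eq_of_mul_le_sum_Icc hw (a := -1 + 1) (b := ((r + 6 : ℕ) : ℤ) - 1 - 1) (c := r + 5) (by omega)
        ?_ (by omega) (by omega)
      simp only [hwdef] at *
      omega
    · obtain ⟨x, H, hX, hZ⟩ := exists_coset_of_triple_sum_disjoint (Y (-1)) (Y (((r + 6 : ℕ) : ℤ) - 1)) hYα
        (hY _ _ _ _ (by omega)) (by simp only [hwdef] at *; omega)
      refine ⟨x, H, ?_, hX, hZ⟩
      rintro rfl
      obtain ⟨y, hy⟩ := hYβ
      exact (hZ y).1 hy trivial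
  · exfalso
    have h1 := hfirst (-2) 1 (-2) (((r + 6 : ℕ) : ℤ) - 1) (by omega) hYα hYβ
    have h2 := hfirst (-1) 0 (-2) (((r + 6 : ℕ) : ℤ) - 1) (by omega) hYα hYβ
    rw [sum_Icc_eq_left_add hαβ, sum_Icc_eq_left_add (by omega), sum_Icc_eq_left_add (by omega),
      sum_Icc_eq_left_add (by omega)] at hsum
    norm_num only at hsum
    have h3 := eq_of_mul_le_sum_Icc hw (a := 2) (b := ((r + 6 : ℕ) : ℤ) - 1) (c := r + 4) (by omega)
      (by
        have : (r + 4) * N = r * N + 4 * N := by ring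
        simp only [hwdef] at *
        push_cast at *
        omega) (t := ((r + 6 : ℕ) : ℤ) - 4) (by omega) (by omega)
    have h4 := hlast (-2) (-2) (-2) (((r + 6 : ℕ) : ℤ) - 4) (by omega) hYα hYα
    omega
  · exfalso
    have h1 := hfirst (((r + 6 : ℕ) : ℤ) - 1) (((r + 6 : ℕ) : ℤ) + 1) (((r + 6 : ℕ) : ℤ) + 1) 0 (by omega) hYβ hYα
    have h2 := hlast (((r + 6 : ℕ) : ℤ) + 1) _ _ 2 (by omega) hYβ hYβ
    rw [sum_Icc_eq_left_add hαβ, sum_Icc_eq_left_add (by omega), sum_Icc_eq_left_add (by omega),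
      sum_Icc_eq_right_add (by omega), sum_Icc_eq_right_add (by omega),
      sum_Icc_eq_right_add (by omega)] at hsum
    have hle := sum_Icc_le_mul hw (a := 0 + 1 + 1 + 1) (b := ((r + 6 : ℕ) : ℤ) + 1 - 1 - 1 - 1) (c := r + 2) (by omega)
    have e1 : (r + 2) * N = r * N + 2 * N := by ring
    rw [e1] at hle
    rw [add_sub_cancel_right] at hle hsum
    norm_num only at hsum hle
    have hw0 := hw 0
    have hw1 := hw 1
    rcases (Y ((r + 6 : ℕ) : ℤ)).eq_empty_or_nonempty with h0 | h0
    · have : w ((r + 6 : ℕ) : ℤ) = 0 := by simp only [hwdef, h0, Finset.card_empty]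
      simp only [hwdef] at *
      push_cast at *
      omega
    · have h3 := hlast (((r + 6 : ℕ) : ℤ) + 1) _ _ 1 (by omega) hYβ h0
      have h4 := hlast ((r + 6 : ℕ) : ℤ) _ _ 0 (by omega) h0 hYβ
      simp only [hwdef] at *
      push_cast at *
      omega
  · right
    have h1 := hlast (-1) (-1) (-1) (((r + 6 : ℕ) : ℤ) - 1) (by omega) hYα hYα
    have h2 := hlast 0 (-1) (-1) ((r + 6 : ℕ) : ℤ) (by omega) hYα hYα
    rw [sum_Icc_eq_right_add hαβ, sum_Icc_eq_left_add (by omega), sum_Icc_eq_right_add (by omega),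
      sum_Icc_eq_left_add (by omega)] at hsum
    norm_num only at hsum
    have e1 : (r + 4) * N = r * N + 4 * N := by ring
    have hle := sum_Icc_le_mul hw (a := 1) (b := ((r + 6 : ℕ) : ℤ) - 1 - 1) (c := r + 4) (by omega)
    refine ⟨?_, Or.inr (Or.inr ⟨rfl, rfl, fun t h3 h4 => huniv t ?_, ?_⟩)⟩
    · rw [sum_Icc_eq_right_add hαβ, sum_Icc_eq_left_add (by omega),
        sum_Icc_eq_right_add (by omega), sum_Icc_eq_left_add (by omega)]
      norm_num only
      simp only [hwdef] at *
      push_cast at *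
      omega
    · refine eq_of_mul_le_sum_Icc hw (a := 1) (b := ((r + 6 : ℕ) : ℤ) - 1 - 1) (c := r + 4) (by omega)
        ?_ (by omega) (by omega)
      simp only [hwdef] at *
      push_cast at *
      omega
    · have hXZ : N ≤ w (-1) + w (((r + 6 : ℕ) : ℤ) - 1) := by
        simp only [hwdef] at *; push_cast at *; omega
      have hYU : N ≤ w 0 + w ((r + 6 : ℕ) : ℤ) := by
        simp only [hwdef] at *; push_cast at *; omega
      obtain ⟨x, H, hX, hZ⟩ := exists_coset_of_triple_sum_disjoint (Y (-1)) (Y (((r + 6 : ℕ) : ℤ) - 1)) hYα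
        (hY _ _ _ _ (by omega)) hXZ
      have hxX : x ∈ Y (-1) := by rw [hX, sub_self]; exact zero_mem _
      have hcompl : (Y 0).image (fun y => y + (x + x)) = (Y ((r + 6 : ℕ) : ℤ))ᶜ := by
        apply Finset.eq_of_subset_of_card_le
        · intro v hv
          obtain ⟨y, hy, rfl⟩ := Finset.mem_image.1 hv
          rw [Finset.mem_compl, ← add_assoc]
          exact hY 0 (-1) (-1) _ (by omega) y hy x hxX x hxX
        · rw [Finset.card_image_of_injective _ (add_left_injective _), Finset.card_compl]
          simp only [hwdef] at *
          omega
      refine ⟨x, H, hX, hZ, fun y => ?_, fun y hy h hh => ?_, fun y hy z hz u hu e => ?_⟩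
      · rw [← Finset.mem_compl, ← hcompl, Finset.mem_image]
        exact ⟨fun h => ⟨y, h, rfl⟩, fun ⟨v, hv, e⟩ => by rwa [← add_right_cancel e]⟩
      · by_contra hn
        rw [← Finset.mem_compl, ← hcompl, Finset.mem_image] at hn
        obtain ⟨v, hv, e⟩ := hn
        refine hY 0 (-1) (-1) ((r + 6 : ℕ) : ℤ) (by omega) v hv x hxX (x - h) ?_ ?_
        · rw [hX]
          convert neg_mem hh using 1
          abel
        · convert hy using 1
          rw [add_assoc, add_sub, ← add_sub_assoc, e, add_sub_cancel_right]
      · exact hY _ _ _ (-1) (by omega) y hy z hz u hu (e ▸ hxX)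

end

lemma exists_linearEquiv_prod_of_functional {F V : Type*} [Field F] [AddCommGroup V] [Module F V]
    [FiniteDimensional F V] {d : ℕ} (hd : Module.finrank F V = d + 1) (φ : V →ₗ[F] F) (hφ : φ ≠ 0) :
    ∃ e : V ≃ₗ[F] F × (Fin d → F), ∀ x, (e x).1 = φ x := by
  have hker : Module.finrank F (LinearMap.ker φ) = Module.finrank F (Fin d → F) := by
    have := Module.Dual.finrank_ker_add_one_of_ne_zero hφ
    rw [Module.finrank_fin_fun]
    omega
  obtain ⟨q, hq⟩ := Submodule.exists_isCompl (LinearMap.ker φ)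
  obtain ⟨v, hv⟩ : ∃ v, φ v ≠ 0 := by
    by_contra! h
    exact hφ (LinearMap.ext h)
  let g := LinearEquiv.ofFinrankEq _ _ hker
  let π : V →ₗ[F] LinearMap.ker φ := (LinearMap.fst F _ _) ∘ₗ
    ((LinearMap.ker φ).prodEquivOfIsCompl q hq).symm.toLinearMap
  have hπ : ∀ y : LinearMap.ker φ, π y = y := fun y => by
    simp [π]
  let L : V →ₗ[F] F × (Fin d → F) := φ.prod (g.toLinearMap ∘ₗ π)
  have hinj : Function.Injective L := by
    rw [← LinearMap.ker_eq_bot, LinearMap.ker_eq_bot']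
    intro x hx
    have h1 : φ x = 0 := congrArg Prod.fst hx
    have h2 : g (π x) = 0 := congrArg Prod.snd hx
    rw [LinearEquiv.map_eq_zero_iff] at h2
    have h3 := hπ ⟨x, h1⟩
    rw [h2] at h3
    exact congrArg Subtype.val h3.symm
  refine ⟨LinearEquiv.ofInjectiveOfFinrankEq L hinj ?_, fun x => ?_⟩
  · rw [hd, Module.finrank_prod, Module.finrank_self, Module.finrank_fin_fun, add_comm]
  · rfl

lemma exists_linearEquiv_prod_of_submodule {F : Type*} [Field F] {d : ℕ}
    (H : Submodule F (Fin d → F)) :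
    ∃ s ≤ d, ∃ f : (Fin d → F) ≃ₗ[F] (Fin s → F) × (Fin (d - s) → F), ∀ y, (f y).1 = 0 ↔ y ∈ H := by
  obtain ⟨q, hq⟩ := Submodule.exists_isCompl H
  have h1 := Submodule.finrank_add_eq_of_isCompl hq
  rw [Module.finrank_fin_fun] at h1
  refine ⟨Module.finrank F q, by omega,
    (q.prodEquivOfIsCompl H hq.symm).symm.trans
      (LinearEquiv.prodCongr (LinearEquiv.ofFinrankEq _ _ (by rw [Module.finrank_fin_fun]))
        (LinearEquiv.ofFinrankEq _ _ (by rw [Module.finrank_fin_fun]; omega))), fun y => ?_⟩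
  rw [← Submodule.prodEquivOfIsCompl_symm_apply_fst_eq_zero q H hq.symm]
  simp

section
variable {p : ℕ} [Fact p.Prime] {E K : Type*} [AddCommGroup E] [AddCommGroup K]
  [Module (ZMod p) E] [Module (ZMod p) K] [Fintype K]

open Classical in
/-- The layers of a set with respect to linear coordinates. -/
noncomputable def coordLayer (e : E ≃ₗ[ZMod p] ZMod p × K) (A : Set E) (i : ZMod p) : Finset K :=
  Finset.univ.filter (fun y => e.symm (i, y) ∈ A)

lemma mem_coordLayer {e : E ≃ₗ[ZMod p] ZMod p × K} {A : Set E} {i : ZMod p} {y : K} :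
    y ∈ coordLayer e A i ↔ e.symm (i, y) ∈ A := by
  simp [coordLayer]

lemma sum_card_coordLayer (e : E ≃ₗ[ZMod p] ZMod p × K) (A : Set E) :
    ∑ i, (coordLayer e A i).card = A.ncard := by
  rw [← Finset.card_sigma, ← Set.ncard_image_of_injective A e.injective, ← Set.ncard_coe_finset]
  rw [← Set.ncard_image_of_injective _ (Equiv.sigmaEquivProd (ZMod p) K).injective]
  congr 1
  ext ⟨i, y⟩
  constructor
  · rintro ⟨⟨j, z⟩, hz, h⟩
    obtain ⟨rfl, rfl⟩ := Prod.mk.injEq .. ▸ h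
    simp only [Finset.coe_sigma, Set.mem_sigma_iff, Finset.mem_coe, mem_coordLayer] at hz
    exact ⟨_, hz.2, by simp⟩
  · rintro ⟨x, hx, h⟩
    refine ⟨⟨i, y⟩, ?_, rfl⟩
    simp only [Finset.coe_sigma, Set.mem_sigma_iff, Finset.mem_coe, mem_coordLayer]
    exact ⟨by simp, by rw [← h]; simpa using hx⟩

lemma layerFree_coordLayer (e : E ≃ₗ[ZMod p] ZMod p × K) (A : Set E)
    (hA : ∀ a ∈ A, ∀ b ∈ A, ∀ c ∈ A, a + b + c ∉ A) : LayerFree (coordLayer e A) := by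
  intro i j k x hx y hy z hz h
  rw [mem_coordLayer] at *
  apply hA _ hx _ hy _ hz
  rw [← map_add, ← map_add]
  exact h

lemma coordLayer_scale (e : E ≃ₗ[ZMod p] ZMod p × K) (A : Set E) {c : ZMod p} (hc : c ≠ 0) :
    ∃ e' : E ≃ₗ[ZMod p] ZMod p × K, ∀ i, coordLayer e' A i = coordLayer e A (c * i) := by
  refine ⟨e.trans (LinearEquiv.prodCongr (LinearEquiv.smulOfNeZero (ZMod p) (ZMod p) c hc).symm
    (LinearEquiv.refl _ _)), fun i => ?_⟩
  ext y
  rw [mem_coordLayer, mem_coordLayer]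
  rfl

end

section
variable {p : ℕ} [Fact p.Prime] {K : Type*} [AddCommGroup K] [Fintype K]
  {X : ZMod p → Finset K}

omit [Fintype K] in
lemma LayerFree.intLayerFree {m : ℕ} (hp : p = 4 * m + 3) (hm : 1 ≤ m) (hX : LayerFree X) :
    IntLayerFree m (fun t => X (extremalStart p m + (t : ZMod p))) := by
  have ha0 := two_mul_extremalStart (p := p) (m := m) (by omega)
  have hp0 : ((4 * m + 3 : ℕ) : ZMod p) = 0 := by rw [← hp]; exact CharP.cast_eq_zero _ _
  push_cast at hp0
  intro t₁ t₂ t₃ t₄ h x hx y hy z hz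
  convert hX _ _ _ x hx y hy z hz using 2
  rcases h with rfl | rfl
  · push_cast
    congr 1
    linear_combination -ha0
  · push_cast
    congr 1
    linear_combination -ha0 - hp0

omit [AddCommGroup K] [Fintype K] in
/-- Shrinking the window so that both end layers are nonempty. -/
lemma exists_tight_window (hX : ∃ i, (X i).Nonempty) (a : ZMod p) {α β : ℤ}
    (h : ∀ x ∈ layerSupp X, ∃ t : ℤ, α ≤ t ∧ t ≤ β ∧ x = a + (t : ZMod p)) :
    ∃ α' β' : ℤ, α ≤ α' ∧ α' ≤ β' ∧ β' ≤ β ∧ (X (a + (α' : ZMod p))).Nonempty ∧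
      (X (a + (β' : ZMod p))).Nonempty ∧
      (∀ x ∈ layerSupp X, ∃ t : ℤ, α' ≤ t ∧ t ≤ β' ∧ x = a + (t : ZMod p)) ∧
      ∑ i, (X i).card ≤ ∑ t ∈ Finset.Icc α' β', (X (a + (t : ZMod p))).card := by
  set T := (Finset.Icc α β).filter (fun t : ℤ => 0 < (X (a + (t : ZMod p))).card) with hT
  have hmem : ∀ x ∈ layerSupp X, ∃ t ∈ T, x = a + (t : ZMod p) := by
    intro x hx
    obtain ⟨t, h1, h2, rfl⟩ := h x hx
    exact ⟨t, Finset.mem_filter.2 ⟨Finset.mem_Icc.2 ⟨h1, h2⟩, Finset.card_pos.2 (mem_layerSupp.1 hx)⟩, rfl⟩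
  have hne : T.Nonempty := by
    obtain ⟨i, hi⟩ := hX
    obtain ⟨t, ht, -⟩ := hmem i (mem_layerSupp.2 hi)
    exact ⟨t, ht⟩
  have h1 := Finset.mem_filter.1 (T.min'_mem hne)
  have h2 := Finset.mem_filter.1 (T.max'_mem hne)
  have hsub : ∀ t ∈ T, T.min' hne ≤ t ∧ t ≤ T.max' hne := fun t ht =>
    ⟨Finset.min'_le _ _ ht, Finset.le_max' _ _ ht⟩
  refine ⟨T.min' hne, T.max' hne, (Finset.mem_Icc.1 h1.1).1, Finset.min'_le _ _ (T.max'_mem hne),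
    (Finset.mem_Icc.1 h2.1).2, Finset.card_pos.1 h1.2, Finset.card_pos.1 h2.2, fun x hx => ?_, ?_⟩
  · obtain ⟨t, ht, rfl⟩ := hmem x hx
    exact ⟨t, (hsub t ht).1, (hsub t ht).2, rfl⟩
  · choose! g hgT hg using hmem
    have h3 : ∑ i, (X i).card = ∑ i ∈ layerSupp X, (X i).card := by
      symm
      apply Finset.sum_subset (Finset.subset_univ _)
      intro x _ hx
      rw [mem_layerSupp, Finset.not_nonempty_iff_eq_empty] at hx
      simp [hx]
    rw [h3]
    have hinj : Set.InjOn g (layerSupp X : Set (ZMod p)) := fun x hx y hy e => by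
      rw [hg x hx, hg y hy, e]
    calc ∑ i ∈ layerSupp X, (X i).card
        = ∑ i ∈ layerSupp X, (X (a + ((g i : ℤ) : ZMod p))).card :=
          Finset.sum_congr rfl fun i hi => by rw [← hg i hi]
      _ = ∑ t ∈ (layerSupp X).image g, (X (a + (t : ZMod p))).card := by
          rw [Finset.sum_image hinj]
      _ ≤ _ := Finset.sum_le_sum_of_subset fun t ht => by
          obtain ⟨x, hx, rfl⟩ := Finset.mem_image.1 ht
          exact Finset.mem_Icc.2 (hsub _ (hgT x hx))

end

lemma image_eq_of_forall_mem_iff {G H : Type*} [AddGroup G] [AddGroup H] (e : G ≃+ H) {A : Set G}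
    {S : Set H} (h : ∀ x, x ∈ A ↔ e x ∈ S) : e '' A = S := by
  ext z
  obtain ⟨x, rfl⟩ := e.surjective z
  rw [e.injective.mem_set_image, h]

lemma mem_Ival_of_int {p : ℕ} {a x : ZMod p} {k : ℕ} {t : ℤ} (h0 : 0 ≤ t) (h1 : t ≤ k)
    (hx : x = a + (t : ZMod p)) : x ∈ Ival a k := by
  lift t to ℕ using h0
  exact ⟨t, by omega, by simpa using hx⟩

section
variable {n m p : ℕ} [Fact p.Prime]
  {e : (Fin n → ZMod p) ≃ₗ[ZMod p] ZMod p × (Fin (n - 1) → ZMod p)} {A : Set (Fin n → ZMod p)}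

lemma mem_iff_mem_coordLayer {E K : Type*} [AddCommGroup E] [AddCommGroup K]
    [Module (ZMod p) E] [Module (ZMod p) K] [Fintype K] (e : E ≃ₗ[ZMod p] ZMod p × K) (A : Set E)
    (x : E) : x ∈ A ↔ (e x).2 ∈ coordLayer e A (e x).1 := by
  rw [mem_coordLayer, Prod.mk.eta, e.symm_apply_apply]

lemma isTrivialKL_of_coordLayer (hp : p = 4 * m + 3)
    (h : ∀ i, (coordLayer e A i).Nonempty →
      ∃ t : ℤ, 0 ≤ t ∧ t ≤ m ∧ i = extremalStart p m + (t : ZMod p)) :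
    IsTrivialKL 3 1 m 1 p n A := by
  refine ⟨e.toAddEquiv, 0, by norm_num, ?_⟩
  rintro _ ⟨x, hx, rfl⟩
  rw [mem_iff_mem_coordLayer e] at hx
  obtain ⟨t, h0, h1, ht⟩ := h _ ⟨_, hx⟩
  have h2 : (2 : ZMod p) ≠ 0 := ZMod.two_ne_zero' (by omega)
  have hp0 : ((4 * m + 3 : ℕ) : ZMod p) = 0 := by rw [← hp]; exact CharP.cast_eq_zero _ _
  push_cast at hp0
  have ha : ajElt 3 1 m p 0 = extremalStart p m := by
    apply mul_left_cancel₀ h2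
    rw [two_mul_extremalStart (by omega), ajElt]
    norm_num
    field_simp
    linear_combination -hp0
  show (e x).1 ∈ Ival _ _
  rw [ha]
  exact mem_Ival_of_int h0 h1 ht

lemma isType1_of_coordLayer (hp : p = 4 * m + 3) (hm : 2 ≤ m) (hcard : A.ncard = m * p ^ (n - 1))
    (h : ∀ i, (coordLayer e A i).Nonempty →
      ∃ t : ℤ, -1 ≤ t ∧ t ≤ m - 2 ∧ i = extremalStart p m + (t : ZMod p))
    (hfull : ∀ t : ℤ, -1 ≤ t → t ≤ m - 2 →
      coordLayer e A (extremalStart p m + (t : ZMod p)) = Finset.univ) :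
    IsType1 3 1 m 1 p n A := by
  have ha0 := two_mul_extremalStart (p := p) (m := m) (by omega)
  have hp0 : ((4 * m + 3 : ℕ) : ZMod p) = 0 := by rw [← hp]; exact CharP.cast_eq_zero _ _
  push_cast at hp0
  refine ⟨hcard, e.toAddEquiv.trans (AddEquiv.neg _), -(extremalStart p m + m - 2), Or.inl ?_, ?_⟩
  · refine ⟨0, le_rfl, ?_⟩
    push_cast
    linear_combination ha0
  · apply image_eq_of_forall_mem_iff
    intro x
    rw [mem_iff_mem_coordLayer e]
    show _ ↔ -(e x).1 ∈ Ival _ _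
    constructor
    · intro hx
      obtain ⟨t, h0, h1, ht⟩ := h _ ⟨_, hx⟩
      refine mem_Ival_of_int (t := m - 2 - t) (by omega) (by omega) ?_
      rw [ht]
      push_cast
      ring
    · rintro ⟨j, hj, hx⟩
      have : (e x).1 = extremalStart p m + ((m - 2 - j : ℤ) : ZMod p) := by
        rw [← neg_neg (e x).1, hx]
        push_cast
        ring
      rw [this, hfull _ (by omega) (by omega)]
      exact Finset.mem_univ _

/-- The shear `(i, y) ↦ (i, y - i • w)`. -/
def shearEquiv {K : Type*} [AddCommGroup K] [Module (ZMod p) K] (w : K) :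
    (ZMod p × K) ≃ₗ[ZMod p] ZMod p × K :=
  LinearEquiv.skewProd (LinearEquiv.refl _ _) (LinearEquiv.refl _ _)
    (-(LinearMap.toSpanSingleton (ZMod p) K w))

lemma shearEquiv_apply {K : Type*} [AddCommGroup K] [Module (ZMod p) K] (w : K)
    (x : ZMod p × K) : shearEquiv w x = (x.1, x.2 - x.1 • w) := by
  simp [shearEquiv, sub_eq_add_neg]

lemma extremalStart_sub_one_ne_zero (hp : p = 4 * m + 3) (hm : 1 ≤ m) : extremalStart p m - 1 ≠ 0 := by
  have ha0 := two_mul_extremalStart (p := p) (m := m) (by omega)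
  intro h
  have h1 : ((m : ℕ) : ZMod p) = 0 := by linear_combination -ha0 + 2 * h
  rw [ZMod.natCast_eq_zero_iff] at h1
  have := Nat.le_of_dvd (by omega) h1
  omega

lemma isType2_of_coordLayer (hp : p = 4 * m + 3) (hm : 2 ≤ m) (hcard : A.ncard = m * p ^ (n - 1))
    (h : ∀ i, (coordLayer e A i).Nonempty →
      ∃ t : ℤ, -1 ≤ t ∧ t ≤ m - 1 ∧ i = extremalStart p m + (t : ZMod p))
    (hfull : ∀ t : ℤ, 0 ≤ t → t ≤ m - 2 →
      coordLayer e A (extremalStart p m + (t : ZMod p)) = Finset.univ)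
    {x : Fin (n - 1) → ZMod p} {H : AddSubgroup (Fin (n - 1) → ZMod p)} (hH : H ≠ ⊤)
    (hX : ∀ y, y ∈ coordLayer e A (extremalStart p m + ((-1 : ℤ) : ZMod p)) ↔ y - x ∈ H)
    (hZ : ∀ y, y ∈ coordLayer e A (extremalStart p m + ((m - 1 : ℤ) : ZMod p)) ↔
      y - (x + x + x) ∉ H) :
    IsType2 3 1 m p n A := by
  have ha0 := two_mul_extremalStart (p := p) (m := m) (by omega)
  have h2 : (2 : ZMod p) ≠ 0 := ZMod.two_ne_zero' (by omega)
  have hs := extremalStart_sub_one_ne_zero hp (by omega)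
  set a := extremalStart p m
  obtain ⟨w, rfl⟩ : ∃ w, x = (a - 1) • w := ⟨(a - 1)⁻¹ • x, by rw [smul_inv_smul₀ hs]⟩
  have hta : type2a 3 1 m p = -(a + m - 1) := by
    have h3 : ((1 : ℕ) : ZMod p) - ((3 : ℕ) : ZMod p) ≠ 0 := by
      intro h; apply h2; push_cast at h; linear_combination -h
    unfold type2a
    rw [← div_eq_mul_inv, div_eq_iff h3]
    push_cast
    linear_combination -ha0
  refine ⟨rfl, ?_, hcard, ((e.trans (shearEquiv w)).toAddEquiv.trans (AddEquiv.neg _)),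
    AddSubgroup.toZModSubmodule p H, ?_, ?_⟩
  · by_contra hn
    have : Subsingleton (Fin (n - 1) → ZMod p) := by
      have : IsEmpty (Fin (n - 1)) := by rw [show n - 1 = 0 by omega]; infer_instance
      infer_instance
    exact hH (Subsingleton.elim _ _)
  · intro hV
    apply hH
    rw [eq_top_iff]
    intro y _
    rw [← AddSubgroup.mem_toZModSubmodule p, hV]
    trivial
  · apply image_eq_of_forall_mem_iff
    intro z
    rw [mem_iff_mem_coordLayer e]
    have hz : (((e.trans (shearEquiv w)).toAddEquiv.trans (AddEquiv.neg _)) z) =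
        (-(e z).1, -((e z).2 - (e z).1 • w)) := by
      show -(shearEquiv w (e z)) = _
      rw [shearEquiv_apply]
      rfl
    rw [hz, hta]
    generalize (e z).1 = i at *
    generalize (e z).2 = y at *
    clear hz
    simp only [Set.mem_union, Set.mem_prod, Set.mem_singleton_iff, Set.mem_sdiff, Set.mem_univ,
      true_and, and_true, SetLike.mem_coe, AddSubgroup.mem_toZModSubmodule, neg_mem_iff]
    have e1 : (a + ((-1 : ℤ) : ZMod p)) • w = (a - 1) • w := by push_cast; rw [sub_eq_add_neg]
    have e2 : (a + ((m - 1 : ℤ) : ZMod p)) • w = (a - 1) • w + (a - 1) • w + (a - 1) • w := by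
      rw [← add_smul, ← add_smul]
      congr 1
      push_cast
      linear_combination -ha0
    constructor
    · intro hy
      obtain ⟨t, h0, h1, rfl⟩ := h _ ⟨_, hy⟩
      obtain rfl | rfl | ht : t = -1 ∨ t = m - 1 ∨ (0 ≤ t ∧ t ≤ m - 2) := by omega
      · right
        refine ⟨by push_cast; ring, ?_⟩
        rw [e1]
        exact (hX _).1 hy
      · left; left
        refine ⟨by push_cast; ring, ?_⟩
        rw [e2]
        exact (hZ _).1 hy
      · left; right
        refine mem_Ival_of_int (t := m - 2 - t) (by omega) (by omega) ?_
        push_cast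
        ring
    · rintro ((⟨hi, hy⟩ | ⟨j, hj, hi⟩) | ⟨hi, hy⟩)
      · have : i = a + ((m - 1 : ℤ) : ZMod p) := by push_cast; linear_combination -hi
        subst this
        rw [hZ, ← e2]
        exact hy
      · have : i = a + ((m - 2 - j : ℤ) : ZMod p) := by push_cast; linear_combination -hi
        rw [this, hfull _ (by omega) (by omega)]
        exact Finset.mem_univ _
      · have : i = a + ((-1 : ℤ) : ZMod p) := by push_cast; linear_combination -hi
        subst this
        rw [hX, ← e1]
        exact hy

lemma isType5_of_coordLayer (hp : p = 4 * m + 3) (hm : 3 ≤ m) (hcard : A.ncard = m * p ^ (n - 1))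
    (h : ∀ i, (coordLayer e A i).Nonempty →
      ∃ t : ℤ, -1 ≤ t ∧ t ≤ m ∧ i = extremalStart p m + (t : ZMod p))
    (hfull : ∀ t : ℤ, 1 ≤ t → t ≤ m - 2 →
      coordLayer e A (extremalStart p m + (t : ZMod p)) = Finset.univ)
    {x : Fin (n - 1) → ZMod p} {H : AddSubgroup (Fin (n - 1) → ZMod p)}
    (hX : ∀ y, y ∈ coordLayer e A (extremalStart p m + ((-1 : ℤ) : ZMod p)) ↔ y - x ∈ H)
    (hZ : ∀ y, y ∈ coordLayer e A (extremalStart p m + ((m - 1 : ℤ) : ZMod p)) ↔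
      y - (x + x + x) ∉ H)
    (hY : ∀ y, y ∈ coordLayer e A (extremalStart p m + ((0 : ℤ) : ZMod p)) ↔
      y + (x + x) ∉ coordLayer e A (extremalStart p m + ((m : ℤ) : ZMod p)))
    (hU : (coordLayer e A (extremalStart p m + ((m : ℤ) : ZMod p))).Nonempty)
    (hUH : ∀ y ∈ coordLayer e A (extremalStart p m + ((m : ℤ) : ZMod p)), ∀ h ∈ H,
      y + h ∈ coordLayer e A (extremalStart p m + ((m : ℤ) : ZMod p)))
    (hU3 : ∀ y ∈ coordLayer e A (extremalStart p m + ((m : ℤ) : ZMod p)),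
      ∀ z ∈ coordLayer e A (extremalStart p m + ((m : ℤ) : ZMod p)),
      ∀ u ∈ coordLayer e A (extremalStart p m + ((m : ℤ) : ZMod p)), y + z + u ≠ x) :
    IsType5 m p n A := by
  have ha0 := two_mul_extremalStart (p := p) (m := m) (by omega)
  have hp0 : ((4 * m + 3 : ℕ) : ZMod p) = 0 := by rw [← hp]; exact CharP.cast_eq_zero _ _
  push_cast at hp0
  have hs := extremalStart_sub_one_ne_zero hp (by omega)
  have hadef : extremalStart p m = ((m + 2 : ℕ) : ZMod p) * (2 : ZMod p)⁻¹ := rfl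
  obtain ⟨s, hsd, f, hf⟩ := exists_linearEquiv_prod_of_submodule (AddSubgroup.toZModSubmodule p H)
  simp only [AddSubgroup.mem_toZModSubmodule] at hf
  unfold IsType5 type5A0
  rw [← hadef]
  set a := extremalStart p m
  set U := coordLayer e A (a + ((m : ℤ) : ZMod p)) with hUdef
  obtain ⟨w, rfl⟩ : ∃ w, x = (a - 1) • w := ⟨(a - 1)⁻¹ • x, by rw [smul_inv_smul₀ hs]⟩
  set P : Set (Fin s → ZMod p) :=
    {v | ∃ y, (f y).1 = v ∧ y + (a + ((m : ℤ) : ZMod p)) • w ∈ U} with hP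
  have hPU : ∀ y, (f (y - (a + ((m : ℤ) : ZMod p)) • w)).1 ∈ P ↔ y ∈ U := by
    intro y
    constructor
    · rintro ⟨z, hz, hzU⟩
      have h1 : y - (a + ((m : ℤ) : ZMod p)) • w - z ∈ H := by
        rw [← hf, map_sub, Prod.fst_sub, hz, sub_self]
      convert hUH _ hzU _ h1 using 1
      abel
    · intro hy
      exact ⟨_, rfl, by rwa [sub_add_cancel]⟩
  refine ⟨hcard, s, hsd, ((e.trans (shearEquiv w)).trans
    (LinearEquiv.prodCongr (LinearEquiv.refl _ _) f)).toAddEquiv, P, ?_, ?_, ?_⟩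
  · obtain ⟨y, hy⟩ := hU
    exact ⟨_, (hPU y).2 hy⟩
  · intro h0
    obtain ⟨s2, hs2, v3, hv3, e3⟩ := Set.mem_add.1 h0
    obtain ⟨s1, hs1, v2, hv2, e2⟩ := Set.mem_add.1 hs2
    obtain ⟨s0, hs0, v1, hv1, e1⟩ := Set.mem_add.1 hs1
    have hs00 : s0 = 0 := hs0
    obtain ⟨y1, rfl, hy1⟩ := hv1
    obtain ⟨y2, rfl, hy2⟩ := hv2
    obtain ⟨y3, rfl, hy3⟩ := hv3
    have h1 : y1 + y2 + y3 ∈ H := by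
      rw [← hf, map_add, map_add, Prod.fst_add, Prod.fst_add, ← e3, ← e2, ← e1, hs00, zero_add]
    refine hU3 _ hy1 _ hy2 _ (hUH _ hy3 _ (neg_mem h1)) ?_
    have : (a - 1) • w = (a + ((m : ℤ) : ZMod p)) • w + (a + ((m : ℤ) : ZMod p)) • w +
        (a + ((m : ℤ) : ZMod p)) • w := by
      rw [← add_smul, ← add_smul]
      congr 1
      push_cast
      linear_combination -ha0 - hp0
    rw [this]
    abel
  · apply image_eq_of_forall_mem_iff
    intro z
    rw [mem_iff_mem_coordLayer e]
    have hz : ((e.trans (shearEquiv w)).trans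
        (LinearEquiv.prodCongr (LinearEquiv.refl _ _) f)).toAddEquiv z =
        ((e z).1, f ((e z).2 - (e z).1 • w)) := by
      show (LinearEquiv.prodCongr (LinearEquiv.refl _ _) f) (shearEquiv w (e z)) = _
      rw [shearEquiv_apply]
      rfl
    rw [hz]
    generalize (e z).1 = i at *
    generalize (e z).2 = y at *
    clear hz
    simp only [Set.mem_ofPred_eq, Set.mem_union, Set.mem_prod, Set.mem_singleton_iff, Set.mem_sdiff,
      Set.mem_univ, true_and, and_true, Prod.mk.injEq, hf]
    have e1 : (a + ((-1 : ℤ) : ZMod p)) • w = (a - 1) • w := by push_cast; rw [sub_eq_add_neg]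
    have e2 : (a + ((m - 1 : ℤ) : ZMod p)) • w = (a - 1) • w + (a - 1) • w + (a - 1) • w := by
      rw [← add_smul, ← add_smul]
      congr 1
      push_cast
      linear_combination -ha0
    have e3 : (a + ((0 : ℤ) : ZMod p)) • w =
        (a + ((m : ℤ) : ZMod p)) • w - ((a - 1) • w + (a - 1) • w) := by
      rw [← add_smul, ← sub_smul]
      congr 1
      push_cast
      linear_combination ha0
    have hP0 : ∀ y, (f (y - (a + ((0 : ℤ) : ZMod p)) • w)).1 ∈ P ↔
        y + ((a - 1) • w + (a - 1) • w) ∈ U := by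
      intro y
      rw [← hPU, e3]
      congr! 3
      abel
    constructor
    · intro hy
      obtain ⟨t, h0, h1, rfl⟩ := h _ ⟨_, hy⟩
      obtain rfl | rfl | ht | rfl | rfl :
        t = -1 ∨ t = 0 ∨ (1 ≤ t ∧ t ≤ m - 2) ∨ t = m - 1 ∨ t = m := by omega
      · left; left; left; left
        refine ⟨by push_cast; ring, ?_⟩
        rw [e1]
        exact (hX _).1 hy
      · left; left; left; right
        refine ⟨by push_cast; ring, ?_⟩
        rw [hP0]
        exact (hY _).1 hy
      · left; left; right
        refine mem_Ival_of_int (t := t - 1) (by omega) (by omega) ?_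
        push_cast
        ring
      · left; right
        refine ⟨by push_cast; ring, ?_⟩
        rw [e2]
        exact (hZ _).1 hy
      · right
        exact ⟨by push_cast; ring, (hPU _).2 hy⟩
    · rintro ((((⟨hi, hy⟩ | ⟨hi, hy⟩) | ⟨j, hj, hi⟩) | ⟨hi, hy⟩) | ⟨hi, hy⟩)
      · have : i = a + ((-1 : ℤ) : ZMod p) := by push_cast; linear_combination hi
        subst this
        rw [hX, ← e1]
        exact hy
      · have : i = a + ((0 : ℤ) : ZMod p) := by push_cast; linear_combination hi
        subst this
        rw [hP0] at hy
        exact (hY _).2 hy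
      · have : i = a + ((j + 1 : ℤ) : ZMod p) := by push_cast; linear_combination hi
        rw [this, hfull _ (by omega) (by omega)]
        exact Finset.mem_univ _
      · have : i = a + ((m - 1 : ℤ) : ZMod p) := by push_cast; linear_combination hi
        subst this
        rw [hZ, ← e2]
        exact hy
      · have : i = a + ((m : ℤ) : ZMod p) := by push_cast; linear_combination hi
        subst this
        exact (hPU _).1 hy

end

lemma KLFree.add_notMem {G : Type*} [AddCommMonoid G] {A : Set G} (h : KLFree 3 1 A) :
    ∀ a ∈ A, ∀ b ∈ A, ∀ c ∈ A, a + b + c ∉ A := by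
  intro a ha b hb c hc hd
  have h1 : ∀ x ∈ A, x ∈ itSum 1 A := fun x hx =>
    Set.mem_add.2 ⟨0, Set.mem_singleton _, x, hx, zero_add x⟩
  have h3 : a + b + c ∈ itSum 3 A := Set.add_mem_add (Set.add_mem_add (h1 a ha) hb) hc
  exact Set.eq_empty_iff_forall_notMem.1 h _ ⟨h3, h1 _ hd⟩

section
variable {n m p : ℕ} [Fact p.Prime] {A : Set (Fin n → ZMod p)}

/-- A dense sum-free set one of whose layers is dense is trivial or of a known type. -/
lemma classification_of_dense_layer {τ : ℝ} (hp : p = 4 * m + 3) (hm : 23 ≤ m)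
    (hfeas : Feasible (1 / 4 : ℝ) τ) (hτ : 5 ≤ τ * m)
    (hfree : ∀ a ∈ A, ∀ b ∈ A, ∀ c ∈ A, a + b + c ∉ A) (hcard : m * p ^ (n - 1) ≤ A.ncard)
    (e : (Fin n → ZMod p) ≃ₗ[ZMod p] ZMod p × (Fin (n - 1) → ZMod p))
    (hbig : ∃ i, m * p ^ (n - 1) ≤ (m + 1) * (coordLayer e A i).card) :
    IsTrivialKL 3 1 m 1 p n A ∨ IsNormalKL 3 1 m 1 p n A ∨ IsType5 m p n A := by
  have hK : Fintype.card (Fin (n - 1) → ZMod p) = p ^ (n - 1) := by simp [ZMod.card]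
  have hodd : Odd (Fintype.card (Fin (n - 1) → ZMod p)) := by
    rw [hK]
    exact Odd.pow ⟨2 * m + 1, by omega⟩
  rw [← hK] at hbig
  obtain ⟨c, hc, α, β, hα, hβ, hD, hsupp⟩ := (layerFree_coordLayer e A hfree).exists_normalized hp hm
    hodd (by rw [hK, sum_card_coordLayer]; exact hcard) hbig hfeas hτ
  obtain ⟨e', he'⟩ := coordLayer_scale e A hc
  have hX := layerFree_coordLayer e' A hfree
  rw [← funext he'] at hsupp
  have hsum := sum_card_coordLayer e' A
  have hne : ∃ i, (coordLayer e' A i).Nonempty := by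
    by_contra! h
    have : A.ncard = 0 := by
      rw [← hsum]
      simp [h]
    have h2 : 0 < m * p ^ (n - 1) := Nat.mul_pos (by omega) (pow_pos (by omega) _)
    omega
  obtain ⟨α', β', h1, h2, h3, hYα, hYβ, hwin, hle⟩ := exists_tight_window hne _ hsupp
  rw [hsum] at hle
  replace hwin : ∀ i, (coordLayer e' A i).Nonempty →
      ∃ t : ℤ, α' ≤ t ∧ t ≤ β' ∧ i = extremalStart p m + (t : ZMod p) :=
    fun i hi => hwin i (mem_layerSupp.2 hi)
  have hcl := (hX.intLayerFree hp (by omega)).classification hm (h1.trans' hα) (h3.trans hβ)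
    (by omega) hYα hYβ h2 (by rw [hK]; exact hcard.trans hle)
  rw [hK] at hcl
  rcases hcl with ⟨h0, h4⟩ | ⟨hub, hcl⟩
  · left
    refine isTrivialKL_of_coordLayer (e := e') hp fun i hi => ?_
    obtain ⟨t, h5, h6, h7⟩ := hwin i hi
    exact ⟨t, h0.trans h5, h6.trans h4, h7⟩
  have hcardeq : A.ncard = m * p ^ (n - 1) := le_antisymm (hle.trans hub) hcard
  rcases hcl with ⟨rfl, rfl, hfull⟩ | ⟨rfl, rfl, hfull, x, H, hH, hx, hz⟩ |
    ⟨rfl, rfl, hfull, x, H, hx, hz, hy, hu, hu3⟩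
  · exact Or.inr (Or.inl (Or.inl (isType1_of_coordLayer (e := e') hp (by omega) hcardeq hwin hfull)))
  · exact Or.inr (Or.inl (Or.inr
      (isType2_of_coordLayer (e := e') hp (by omega) hcardeq hwin hfull hH hx hz)))
  · exact Or.inr (Or.inr
      (isType5_of_coordLayer (e := e') hp (by omega) hcardeq hwin hfull hx hz hy hYβ hu hu3))

lemma exists_dense_coordLayer (hn : 1 ≤ n) (hp : p = 4 * m + 3) (hm : 9 ≤ m) (hA : A.Nonempty)
    (hfree : ∀ a ∈ A, ∀ b ∈ A, ∀ c ∈ A, a + b + c ∉ A) (hcard : m * p ^ (n - 1) ≤ A.ncard) :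
    ∃ (e : (Fin n → ZMod p) ≃ₗ[ZMod p] ZMod p × (Fin (n - 1) → ZMod p)) (i : ZMod p),
      m * p ^ (n - 1) ≤ (m + 1) * (coordLayer e A i).card := by
  classical
  have hfr : Module.finrank (ZMod p) (Fin n → ZMod p) = n - 1 + 1 := by
    rw [Module.finrank_fin_fun]; omega
  have hcoord : ∀ u : Fin n → ZMod p, u ≠ 0 →
      ∃ e : (Fin n → ZMod p) ≃ₗ[ZMod p] ZMod p × (Fin (n - 1) → ZMod p), ∀ x, (e x).1 = u ⬝ᵥ x := by
    intro u hu
    obtain ⟨i, hi⟩ := Function.ne_iff.1 hu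
    let φ : (Fin n → ZMod p) →ₗ[ZMod p] ZMod p :=
      { toFun := fun x => u ⬝ᵥ x
        map_add' := fun x y => dotProduct_add u x y
        map_smul' := fun c x => dotProduct_smul c u x }
    refine exists_linearEquiv_prod_of_functional hfr φ fun h => hi ?_
    have : u ⬝ᵥ Pi.single i 1 = 0 := LinearMap.congr_fun h (Pi.single i 1)
    simpa using this
  rcases Nat.lt_or_ge n 2 with h1 | h2
  · obtain rfl : n = 1 := by omega
    obtain ⟨e, -⟩ := hcoord 1 one_ne_zero
    obtain ⟨x, hx⟩ := hA
    rw [mem_iff_mem_coordLayer e] at hx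
    refine ⟨e, (e x).1, ?_⟩
    have := Finset.card_pos.2 ⟨_, hx⟩
    have h3 : m * p ^ (1 - 1) = m := by simp
    rw [h3]
    nlinarith
  · have hN : p ^ (n - 1) = p * p ^ (n - 2) := by
      rw [← pow_succ']; congr 1; omega
    obtain ⟨u, hu, i, hi⟩ := exists_dense_fiber (n := n) (N' := p ^ (n - 2)) hp hm
      (by rw [← hN, ← pow_succ']; congr 1; omega) A.toFinset
      (by simpa only [Set.mem_toFinset] using hfree)
      (by rw [← hN, ← Set.ncard_eq_toFinset_card']; exact hcard)
    obtain ⟨e, he⟩ := hcoord u hu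
    have hK : Fintype.card (Fin (n - 1) → ZMod p) = p ^ (n - 1) := by simp [ZMod.card]
    have hX := layerFree_coordLayer e A hfree
    have hfib : (A.toFinset.filter (fun x => u ⬝ᵥ x = i)).card ≤ (coordLayer e A i).card := by
      refine Finset.card_le_card_of_injOn (fun x => (e x).2) ?_ ?_
      · intro x hx
        simp only [Finset.coe_filter, Set.mem_toFinset, Set.mem_ofPred_eq] at hx
        rw [Finset.mem_coe, ← hx.2, ← he]
        exact (mem_iff_mem_coordLayer e A x).1 hx.1
      · intro x hx y hy hxy
        simp only [Finset.coe_filter, Set.mem_toFinset, Set.mem_ofPred_eq] at hx hy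
        apply e.injective
        refine Prod.ext ?_ hxy
        rw [he, he, hx.2, hy.2]
    rcases weight_dichotomy (N := p ^ (n - 1)) (N' := p ^ (n - 2)) hp (by omega) hN
      (Odd.pow ⟨2 * m + 1, by omega⟩) (fun i => (coordLayer e A i).card) (fun i j k hi hj hk hl => by
        rw [← hK]
        refine card_sum_le_of_disjoint (fun H hH => ?_) _ _ _ _ (Finset.card_pos.1 hi)
          (Finset.card_pos.1 hj) (Finset.card_pos.1 hk) (Finset.card_pos.1 hl) (hX i j k)
        have := mul_card_addSubgroup_le hK H hH
        rw [hN] at this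
        exact Nat.le_of_mul_le_mul_left this (by omega))
      (by rw [sum_card_coordLayer]; exact hcard) with h | ⟨j, hj⟩
    · exact absurd (h i) (by simp only [not_le]; exact hi.trans_le hfib)
    · exact ⟨e, j, hj⟩

end

/-- (`(k,ℓ) = (3,1)`, `p = 4m+3`.) Every nontrivial `(3,1)`-sum-free
set `A ⊆ F_p^n` with `|A| ≥ m·p^(n-1)` is normal or of type 5. -/
theorem stmt4 (n m p : ℕ) (τ : ℝ)
    (hn : 1 ≤ n) (hp : p = 4 * m + 3) (hpp : p.Prime)
    (hτ0 : 0 < τ) (hτ1 : τ ≤ 1) (hfeas : Feasible (1 / 4 : ℝ) τ)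
    (hm1 : 5 / τ ≤ (m : ℝ)) (hm2 : 23 ≤ m)
    (A : Set (Fin n → ZMod p)) (hA : A.Nonempty) (hfree : KLFree 3 1 A)
    (hnt : ¬ IsTrivialKL 3 1 m 1 p n A) (hcard : m * p ^ (n - 1) ≤ A.ncard) :
    IsNormalKL 3 1 m 1 p n A ∨ IsType5 m p n A := by
  have : Fact p.Prime := ⟨hpp⟩
  have hτ : 5 ≤ τ * m := by
    rw [div_le_iff₀ hτ0] at hm1
    linarith
  obtain ⟨e, i, hi⟩ := exists_dense_coordLayer hn hp (by omega) hA hfree.add_notMem hcard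
  exact (classification_of_dense_layer hp hm2 hfeas hτ hfree.add_notMem hcard e ⟨i, hi⟩).resolve_left
    hnt
end

section
/- Let p be a prime and let N be an integer with 2 ≤ N ≤ p−2. Suppose x, y ∈ F_p and d_1, d_2 ∈ F_p ∖ {0} satisfy {x + i·d_1 : i = 0, 1, ..., N−1} = {y + i·d_2 : i = 0, 1, ..., N−1} as subsets of F_p. Then d_2 = d_1 or d_2 = −d_1. -/
open Pointwise

/-- If two progressions of length `N` coincide, and `d₂ = k • d₁`, then a term `x + i • d₁` of the
first whose predecessor index `i - k` is in `[N - p, 0)` is the initial term of the second. -/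
lemma eq_start_of_progression_eq {p N : ℕ} [Fact p.Prime] {x y d₁ d₂ : ZMod p} (hd₁ : d₁ ≠ 0)
    (h : {z : ZMod p | ∃ i : ℕ, i < N ∧ z = x + (i : ZMod p) * d₁} =
         {z : ZMod p | ∃ i : ℕ, i < N ∧ z = y + (i : ZMod p) * d₂})
    {k i : ℕ} (hk : d₂ = k * d₁) (hiN : i < N) (hik : i < k) (hki : N + k ≤ i + p) :
    x + (i : ZMod p) * d₁ = y := by
  have hi : x + (i : ZMod p) * d₁ ∈ {z : ZMod p | ∃ i : ℕ, i < N ∧ z = y + (i : ZMod p) * d₂} :=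
    h ▸ ⟨i, hiN, rfl⟩
  obtain ⟨_ | j, hj, hij⟩ := hi
  · simpa using hij
  have hpred : y + (j : ZMod p) * d₂ ∈
      {z : ZMod p | ∃ i : ℕ, i < N ∧ z = x + (i : ZMod p) * d₁} :=
    h.symm ▸ ⟨j, by omega, rfl⟩
  obtain ⟨l, hl, hjl⟩ := hpred
  have hmul : ((l + k - i : ℤ) : ZMod p) * d₁ = 0 := by
    push_cast at hij ⊢
    linear_combination -hij - hjl - hk
  have hzero := (mul_eq_zero.mp hmul).resolve_right hd₁
  have hdvd := (ZMod.intCast_zmod_eq_zero_iff_dvd _ p).mp hzero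
  have := Int.le_of_dvd (by omega) hdvd
  omega

/-- An arithmetic progression in `F_p` of length `N` with `2 ≤ N ≤ p-2`
determines its common difference up to sign. -/
theorem stmt5 (p N : ℕ) (hp : p.Prime) (hN2 : 2 ≤ N) (hNp : N ≤ p - 2)
    (x y d₁ d₂ : ZMod p) (hd₁ : d₁ ≠ 0) (hd₂ : d₂ ≠ 0)
    (h : {z : ZMod p | ∃ i : ℕ, i < N ∧ z = x + (i : ZMod p) * d₁} =
         {z : ZMod p | ∃ i : ℕ, i < N ∧ z = y + (i : ZMod p) * d₂}) :
    d₂ = d₁ ∨ d₂ = -d₁ := by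
  have : Fact p.Prime := ⟨hp⟩
  obtain ⟨k, hkp, hk⟩ : ∃ k : ℕ, k < p ∧ d₂ = k * d₁ :=
    ⟨(d₂ / d₁).val, ZMod.val_lt _, by rw [ZMod.natCast_zmod_val, div_mul_cancel₀ _ hd₁]⟩
  have hk0 : k ≠ 0 := by
    rintro rfl
    exact hd₂ (by simpa using hk)
  by_cases hk1 : k = 1
  · left
    simpa [hk1] using hk
  by_cases hkp1 : k + 1 = p
  · right
    have hcast : (k : ZMod p) + 1 = 0 := by
      rw [← Nat.cast_add_one, hkp1, ZMod.natCast_self]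
    linear_combination hk + d₁ * hcast
  exfalso
  obtain ⟨i, hiN, hik, hki⟩ : ∃ i : ℕ, i + 1 < N ∧ i + 1 < k ∧ N + k ≤ i + p :=
    ⟨N + k - p, by omega, by omega, by omega⟩
  have h₀ := eq_start_of_progression_eq hd₁ h hk (by omega) (by omega) hki
  have h₁ := eq_start_of_progression_eq hd₁ h hk hiN hik (by omega)
  push_cast at h₁
  exact hd₁ (by linear_combination h₁ - h₀)
end

section
/- Let p be a prime, a ∈ F_p, and t an integer with 3 ≤ t ≤ p−4, and set I = [a, a+t] (so 4 ≤ |I| ≤ p−3). Then for every x ∈ I ∖ {a, a+t}, the set I ∖ {x} is not an arithmetic progression in F_p; that is, there exist no y ∈ F_p and d ∈ F_p ∖ {0} such that I ∖ {x} = {y + i·d : 0 ≤ i ≤ t−1}. -/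
open Pointwise

/-- The index of a point of `ZMod p` along the arithmetic progression `y, y + d, y + 2d, …`. -/
theorem exists_nat_lt_eq_add_mul {p : ℕ} [Fact p.Prime] (y : ZMod p) {d : ZMod p} (hd : d ≠ 0)
    (z : ZMod p) : ∃ n : ℕ, n < p ∧ z = y + (n : ZMod p) * d := by
  refine ⟨((z - y) / d).val, ZMod.val_lt _, ?_⟩
  rw [ZMod.natCast_zmod_val, div_mul_cancel₀ _ hd]
  ring

theorem natCast_inj_of_lt {p m n : ℕ} (hm : m < p) (hn : n < p)
    (h : (m : ZMod p) = (n : ZMod p)) : m = n := by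
  rw [ZMod.natCast_eq_natCast_iff] at h
  exact Nat.ModEq.eq_of_lt_of_lt h hm hn

theorem add_mul_mem_progression_iff {p : ℕ} [Fact p.Prime] (y : ZMod p) {d : ZMod p} (hd : d ≠ 0)
    {t n : ℕ} (ht : t ≤ p) (hn : n < p) :
    y + (n : ZMod p) * d ∈ {z : ZMod p | ∃ i : ℕ, i < t ∧ z = y + (i : ZMod p) * d} ↔ n < t := by
  constructor
  · rintro ⟨i, hi, h⟩
    have := natCast_inj_of_lt hn (hi.trans_le ht) (mul_right_cancel₀ hd (add_left_cancel h))
    omega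
  · exact fun h => ⟨n, h, rfl⟩

/-- A step `u` leads from outside a progression of length `t` into it exactly when it wraps
around `p` and lands among the first `t` indices. -/
theorem add_mul_add_mem_progression_iff {p : ℕ} [Fact p.Prime] (y : ZMod p) {d : ZMod p}
    (hd : d ≠ 0) {t n u : ℕ} (ht : t ≤ p) (hn : n < p) (htn : t ≤ n) (hu : u < p) :
    y + (n : ZMod p) * d + (u : ZMod p) * d ∈
        {z : ZMod p | ∃ i : ℕ, i < t ∧ z = y + (i : ZMod p) * d} ↔
      p ≤ n + u ∧ n + u < p + t := by
  have e : y + (n : ZMod p) * d + (u : ZMod p) * d = y + ((n + u : ℕ) : ZMod p) * d := by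
    push_cast; ring
  rw [e]
  by_cases h : n + u < p
  · rw [add_mul_mem_progression_iff y hd ht h]
    omega
  · have e' : ((n + u : ℕ) : ZMod p) = ((n + u - p : ℕ) : ZMod p) := by
      rw [Nat.cast_sub (by omega), ZMod.natCast_self, sub_zero]
    rw [e', add_mul_mem_progression_iff y hd ht (by omega)]
    omega

/-- An arithmetic progression `S` of length `t` with `3 ≤ t ≤ p - 4` cannot have exactly two
points `b ≠ x` outside `S` whose successors lie in `S`, when moreover `x - 1 ∈ S`. -/
theorem not_progression_of_isolated_gap {p : ℕ} [Fact p.Prime] {t : ℕ} (ht : 3 ≤ t)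
    (htp : t + 4 ≤ p) (y : ZMod p) {d : ZMod p} (hd : d ≠ 0) {S : Set (ZMod p)}
    (hS : S = {z : ZMod p | ∃ i : ℕ, i < t ∧ z = y + (i : ZMod p) * d}) {b x : ZMod p}
    (hbx : b ≠ x) (hb : b ∉ S) (hb' : b + 1 ∈ S) (hx : x ∉ S) (hx' : x + 1 ∈ S)
    (hx'' : x - 1 ∈ S) (hexit : ∀ c, c ∉ S → c + 1 ∈ S → c = b ∨ c = x) : False := by
  obtain ⟨u, hu, hu1⟩ := exists_nat_lt_eq_add_mul 0 hd 1
  rw [zero_add] at hu1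
  obtain ⟨m, hm, rfl⟩ := exists_nat_lt_eq_add_mul y hd b
  obtain ⟨n, hn, rfl⟩ := exists_nat_lt_eq_add_mul y hd x
  have hmn : m ≠ n := fun h => hbx (by rw [h])
  have hle : t ≤ p := by omega
  have mem : ∀ {k : ℕ}, k < p → (y + (k : ZMod p) * d ∈ S ↔ k < t) := fun hk => by
    rw [hS]; exact add_mul_mem_progression_iff y hd hle hk
  have step : ∀ {k : ℕ}, k < p → t ≤ k →
      (y + (k : ZMod p) * d + 1 ∈ S ↔ p ≤ k + u ∧ k + u < p + t) := fun hk htk => by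
    rw [hS, hu1]; exact add_mul_add_mem_progression_iff y hd hle hk htk hu
  rw [mem hm, not_lt] at hb
  rw [mem hn, not_lt] at hx
  rw [step hm hb] at hb'
  rw [step hn hx] at hx'
  have hback : u ≤ n ∧ n < u + t := by
    have e : y + (n : ZMod p) * d - 1 = y + (n : ZMod p) * d + ((p - u : ℕ) : ZMod p) * d := by
      rw [Nat.cast_sub hu.le, ZMod.natCast_self, zero_sub, neg_mul, ← hu1]
      ring
    rw [e, hS, add_mul_add_mem_progression_iff y hd hle hn hx (by omega)] at hx''
    omega
  have key : ∀ k : ℕ, k < p → t ≤ k → p ≤ k + u → k + u < p + t → k = m ∨ k = n := by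
    intro k hk htk h1 h2
    refine (hexit _ ((mem hk).not.2 (by omega)) ((step hk htk).2 ⟨h1, h2⟩)).imp ?_ ?_ <;>
      exact fun h => natCast_inj_of_lt hk ‹_› (mul_right_cancel₀ hd (add_left_cancel h))
  have k0 := key (p - u)
  have k1 := key (p - u + 1)
  have k2 := key (p - u + 2)
  have l0 := key t
  have l1 := key (t + 1)
  have l2 := key (t + 2)
  omega

/-- Removing an interior point from an interval `[a, a+t]` in `F_p`
(with `4 ≤ t+1 ≤ p-3`) never yields an arithmetic progression. -/
theorem stmt6 (p : ℕ) (hp : p.Prime) (a : ZMod p) (t : ℕ) (ht : 3 ≤ t) (htp : t ≤ p - 4)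
    (x : ZMod p) (hx : x ∈ Ival a t) (hxa : x ≠ a) (hxb : x ≠ a + (t : ZMod p)) :
    ¬∃ (y d : ZMod p), d ≠ 0 ∧
        Ival a t \ {x} = {z : ZMod p | ∃ i : ℕ, i < t ∧ z = y + (i : ZMod p) * d} := by
  rintro ⟨y, d, hd, hS⟩
  have := Fact.mk hp
  have hb : a - 1 ∉ Ival a t := by
    rintro ⟨i, hi, h⟩
    have h0 : ((i + 1 : ℕ) : ZMod p) = ((0 : ℕ) : ZMod p) := by
      push_cast
      linear_combination -h
    have := natCast_inj_of_lt (by omega) (by omega) h0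
    omega
  have hbx : a - 1 ≠ x := fun h => hb (h ▸ hx)
  have hx0 := hx
  obtain ⟨j, hj, rfl⟩ := hx0
  have hj0 : j ≠ 0 := by rintro rfl; simp at hxa
  have hjt : j ≠ t := by rintro rfl; exact hxb rfl
  refine not_progression_of_isolated_gap ht (by omega) y hd hS hbx (fun h => hb h.1)
    ⟨⟨0, by omega, by simp⟩, by simpa using hxa.symm⟩ (fun h => h.2 rfl)
    ⟨⟨j + 1, by omega, by push_cast; ring⟩, by simp⟩
    ⟨⟨j - 1, by omega, by rw [Nat.cast_sub (by omega)]; push_cast; ring⟩, by simp⟩ ?_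
  rintro c hc ⟨⟨i, hi, h⟩, -⟩
  rcases i with _ | i
  · left
    push_cast at h
    linear_combination h
  · right
    by_contra hne
    refine hc ⟨⟨i, by omega, ?_⟩, hne⟩
    push_cast at h
    linear_combination h
end

section
/- Let p be a prime, n ≥ 2, and A, A' ⊆ F_p^n. Let (v, K) and (v', K') be decompositions of F_p^n, with the layers A_i and support Supp(A) taken with respect to (v,K), and the layers A'_i and support Supp(A') taken with respect to (v',K'). Suppose there exists i ∈ F_p with |A_i| = p^{n−1}, and suppose ω(A') < p. If f(A) ⊆ A' for some automorphism f of the additive group (F_p^n,+), then there exists s ∈ F_p such that s·Supp(A) ⊆ Supp(A'). -/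
open Pointwise

/-- A vector outside a subspace of codimension one spans a complement of it. -/
theorem exists_sub_smul_mem_of_finrank {F : Type*} [Field F] {n : ℕ} (K : Submodule F (Fin n → F))
    (hK : Module.finrank F K = n - 1) {v : Fin n → F} (hv : v ∉ K) (x : Fin n → F) :
    ∃ s : F, x - s • v ∈ K := by
  have hlt : K < K ⊔ Submodule.span F {v} :=
    left_lt_sup.2 fun h => hv (h (Submodule.mem_span_singleton_self v))
  have htop : K ⊔ Submodule.span F {v} = ⊤ := by
    apply Submodule.eq_top_of_finrank_eq
    have h₁ := Submodule.finrank_lt_finrank_of_lt hlt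
    have h₂ := Submodule.finrank_le (K ⊔ Submodule.span F {v})
    rw [Module.finrank_fin_fun] at h₂ ⊢
    omega
  obtain ⟨y, hy, z, hz, rfl⟩ := Submodule.mem_sup.1 (htop ▸ Submodule.mem_top (x := x))
  obtain ⟨s, rfl⟩ := Submodule.mem_span_singleton.1 hz
  exact ⟨s, by simpa using hy⟩

/-- A layer with as many elements as the hyperplane is the whole hyperplane. -/
theorem layerKL_eq_of_ncard {p n : ℕ} [Fact p.Prime] {v : Fin n → ZMod p}
    {K : Submodule (ZMod p) (Fin n → ZMod p)} (hK : Module.finrank (ZMod p) K = n - 1)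
    {A : Set (Fin n → ZMod p)} {i : ZMod p} (h : (layerKL v K A i).ncard = p ^ (n - 1)) :
    layerKL v K A i = K := by
  refine Set.eq_of_subset_of_ncard_le (fun x hx => hx.1) ?_ (Set.toFinite _)
  have hcard : Nat.card K = p ^ (n - 1) := by
    rw [Module.natCard_eq_pow_finrank (K := ZMod p), Nat.card_zmod, hK]
  rw [h, ← hcard]
  exact (Nat.card_coe_set_eq (K : Set (Fin n → ZMod p))).ge

/-- If a layer of `A` is full and an additive map sends `A` into a set of non-full support, then it
maps the hyperplane of `A` into the hyperplane of that set. -/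
theorem map_mem_of_layerKL_eq {p n : ℕ} [Fact p.Prime] {A A' : Set (Fin n → ZMod p)}
    {v v' : Fin n → ZMod p} {K K' : Submodule (ZMod p) (Fin n → ZMod p)}
    (hK' : Module.finrank (ZMod p) K' = n - 1) {i : ZMod p} (hi : layerKL v K A i = K)
    (hw : weight v' K' A' < p) (f : (Fin n → ZMod p) →+ (Fin n → ZMod p)) (hf : f '' A ⊆ A')
    {k : Fin n → ZMod p} (hk : k ∈ K) : f k ∈ K' := by
  by_contra hfk
  have huniv : supp v' K' A' = Set.univ := by
    refine Set.eq_univ_of_forall fun j => ?_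
    obtain ⟨c, hc⟩ := exists_sub_smul_mem_of_finrank K' hK' hfk (j • v' - i • f v)
    have hck : c • k ∈ layerKL v K A i := hi ▸ K.smul_mem c hk
    have hA' := hf ⟨_, hck.2, rfl⟩
    refine ⟨f (c • k + i • v) - j • v', ?_, by simpa using hA'⟩
    rw [map_add, ZMod.map_smul, ZMod.map_smul]
    convert K'.neg_mem hc using 1
    abel
  rw [weight, huniv, Set.ncard_univ, Nat.card_zmod] at hw
  exact lt_irrefl p hw

/-- If some layer of `A` (w.r.t. `(v,K)`) is full, `ω(A') < p`
(w.r.t. `(v',K')`), and an additive automorphism maps `A` into `A'`, then some scalar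
multiple of `Supp(A)` is contained in `Supp(A')`. -/
theorem stmt7 (p n : ℕ) (hp : p.Prime) (hn : 2 ≤ n)
    (A A' : Set (Fin n → ZMod p))
    (v : Fin n → ZMod p) (K : Submodule (ZMod p) (Fin n → ZMod p))
    (hK : Module.finrank (ZMod p) K = n - 1) (hv : v ∉ K)
    (v' : Fin n → ZMod p) (K' : Submodule (ZMod p) (Fin n → ZMod p))
    (hK' : Module.finrank (ZMod p) K' = n - 1) (hv' : v' ∉ K')
    (hfull : ∃ i : ZMod p, (layerKL v K A i).ncard = p ^ (n - 1))
    (hw : weight v' K' A' < p)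
    (f : (Fin n → ZMod p) ≃+ (Fin n → ZMod p)) (hf : f '' A ⊆ A') :
    ∃ s : ZMod p, s • supp v K A ⊆ supp v' K' A' := by
  have := Fact.mk hp
  obtain ⟨i, hi⟩ := hfull
  have hmap {k : Fin n → ZMod p} (hk : k ∈ K) : f k ∈ K' :=
    map_mem_of_layerKL_eq hK' (layerKL_eq_of_ncard hK hi) hw f.toAddMonoidHom hf hk
  obtain ⟨s, hs⟩ := exists_sub_smul_mem_of_finrank K' hK' hv' (f v)
  refine ⟨s, ?_⟩
  rintro _ ⟨j, ⟨x, hx, hxA⟩, rfl⟩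
  refine ⟨f x + j • (f v - s • v'), K'.add_mem (hmap hx) (K'.smul_mem j hs), ?_⟩
  convert hf ⟨_, hxA, rfl⟩ using 1
  rw [map_add, ZMod.map_smul]
  module
end
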